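/- arXiv:2107.03118 — 3 statements merged into one kernel-verified Lean document; each statement's English description precedes it below -/
import Mathlib

section
/- For every t ≥ 0, the mean temperature satisfies α₁ ≤ ∫₀¹ θ(x,t) dx ≤ α₂. -/
open MeasureTheory Real Set Filter Topology

/-- A classical solution on `[0,1] × [0,∞)` of the rescaled stress-free
one-dimensional compressible Navier–Stokes system
`u_t + u = v_x`, `v_t = ((v_x - θ)/u)_x`,
`θ_t = -θ v_x/u + v_x²/u + (θ^β θ_x/u)_x` (β > 0),
with stress-free, thermally insulated boundary conditions and positive data. -/
structure NSSol where
  β : ℝ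
  hβ : 0 < β
  u : ℝ → ℝ → ℝ
  v : ℝ → ℝ → ℝ
  θ : ℝ → ℝ → ℝ
  ux : ℝ → ℝ → ℝ
  ut : ℝ → ℝ → ℝ
  vx : ℝ → ℝ → ℝ
  vt : ℝ → ℝ → ℝ
  vxx : ℝ → ℝ → ℝ
  θx : ℝ → ℝ → ℝ
  θt : ℝ → ℝ → ℝ
  θxx : ℝ → ℝ → ℝ
  hu_pos : ∀ x ∈ Icc (0:ℝ) 1, ∀ t ∈ Ici (0:ℝ), 0 < u x t
  hθ_pos : ∀ x ∈ Icc (0:ℝ) 1, ∀ t ∈ Ici (0:ℝ), 0 < θ x t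
  hux : ∀ x ∈ Icc (0:ℝ) 1, ∀ t ∈ Ici (0:ℝ),
    HasDerivWithinAt (fun y => u y t) (ux x t) (Icc 0 1) x
  hut : ∀ x ∈ Icc (0:ℝ) 1, ∀ t ∈ Ici (0:ℝ),
    HasDerivWithinAt (fun s => u x s) (ut x t) (Ici 0) t
  hvx : ∀ x ∈ Icc (0:ℝ) 1, ∀ t ∈ Ici (0:ℝ),
    HasDerivWithinAt (fun y => v y t) (vx x t) (Icc 0 1) x
  hvt : ∀ x ∈ Icc (0:ℝ) 1, ∀ t ∈ Ici (0:ℝ),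
    HasDerivWithinAt (fun s => v x s) (vt x t) (Ici 0) t
  hvxx : ∀ x ∈ Icc (0:ℝ) 1, ∀ t ∈ Ici (0:ℝ),
    HasDerivWithinAt (fun y => vx y t) (vxx x t) (Icc 0 1) x
  hθx : ∀ x ∈ Icc (0:ℝ) 1, ∀ t ∈ Ici (0:ℝ),
    HasDerivWithinAt (fun y => θ y t) (θx x t) (Icc 0 1) x
  hθt : ∀ x ∈ Icc (0:ℝ) 1, ∀ t ∈ Ici (0:ℝ),
    HasDerivWithinAt (fun s => θ x s) (θt x t) (Ici 0) t
  hθxx : ∀ x ∈ Icc (0:ℝ) 1, ∀ t ∈ Ici (0:ℝ),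
    HasDerivWithinAt (fun y => θx y t) (θxx x t) (Icc 0 1) x
  hu_cont : ContinuousOn (Function.uncurry u) (Icc 0 1 ×ˢ Ici 0)
  hv_cont : ContinuousOn (Function.uncurry v) (Icc 0 1 ×ˢ Ici 0)
  hθ_cont : ContinuousOn (Function.uncurry θ) (Icc 0 1 ×ˢ Ici 0)
  hux_cont : ContinuousOn (Function.uncurry ux) (Icc 0 1 ×ˢ Ici 0)
  hut_cont : ContinuousOn (Function.uncurry ut) (Icc 0 1 ×ˢ Ici 0)
  hvx_cont : ContinuousOn (Function.uncurry vx) (Icc 0 1 ×ˢ Ici 0)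
  hvt_cont : ContinuousOn (Function.uncurry vt) (Icc 0 1 ×ˢ Ici 0)
  hvxx_cont : ContinuousOn (Function.uncurry vxx) (Icc 0 1 ×ˢ Ici 0)
  hθx_cont : ContinuousOn (Function.uncurry θx) (Icc 0 1 ×ˢ Ici 0)
  hθt_cont : ContinuousOn (Function.uncurry θt) (Icc 0 1 ×ˢ Ici 0)
  hθxx_cont : ContinuousOn (Function.uncurry θxx) (Icc 0 1 ×ˢ Ici 0)
  mass : ∀ x ∈ Icc (0:ℝ) 1, ∀ t ∈ Ici (0:ℝ), ut x t + u x t = vx x t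
  momentum : ∀ x ∈ Icc (0:ℝ) 1, ∀ t ∈ Ici (0:ℝ),
    HasDerivWithinAt (fun y => (vx y t - θ y t) / u y t) (vt x t) (Icc 0 1) x
  energyEq : ∀ x ∈ Icc (0:ℝ) 1, ∀ t ∈ Ici (0:ℝ),
    HasDerivWithinAt (fun y => θ y t ^ β * θx y t / u y t)
      (θt x t + θ x t * vx x t / u x t - (vx x t) ^ 2 / u x t) (Icc 0 1) x
  bc0 : ∀ t ∈ Ici (0:ℝ), (vx 0 t - θ 0 t) / u 0 t = 0
  bc1 : ∀ t ∈ Ici (0:ℝ), (vx 1 t - θ 1 t) / u 1 t = 0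
  bcθ0 : ∀ t ∈ Ici (0:ℝ), θx 0 t = 0
  bcθ1 : ∀ t ∈ Ici (0:ℝ), θx 1 t = 0

namespace NSSol

/-- The initial energy `E₀ = ∫₀¹ (v₀²/2 + θ₀) dx`. -/
noncomputable def E₀ (S : NSSol) : ℝ := ∫ x in (0:ℝ)..1, ((S.v x 0) ^ 2 / 2 + S.θ x 0)

/-- The dissipation functional
`V(t) = ∫₀¹ (θ^β θ_x²/(uθ²) + (v_x − θ)²/(uθ)) dx`. -/
noncomputable def V (S : NSSol) (t : ℝ) : ℝ :=
  ∫ x in (0:ℝ)..1,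
    (S.θ x t ^ S.β * (S.θx x t) ^ 2 / (S.u x t * (S.θ x t) ^ 2)
      + (S.vx x t - S.θ x t) ^ 2 / (S.u x t * S.θ x t))

/-- The auxiliary velocity
`w(x,t) = v(x,t) − ∫₀¹ v₀ dξ − ∫₀ˣ u(ξ,t) dξ + ∫₀¹∫₀^ξ u(η,t) dη dξ`,
which satisfies `w_x = v_x − u` and `∫₀¹ w dx = 0`. -/
noncomputable def w (S : NSSol) (x t : ℝ) : ℝ :=
  S.v x t - (∫ ξ in (0:ℝ)..1, S.v ξ 0) - (∫ ξ in (0:ℝ)..x, S.u ξ t)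
    + ∫ ξ in (0:ℝ)..1, ∫ η in (0:ℝ)..ξ, S.u η t

/-- The asymptotic state `A = 2√(36 + 3(2E₀ − (∫₀¹ v₀ dx)²)) − 12`. -/
noncomputable def A (S : NSSol) : ℝ :=
  2 * Real.sqrt (36 + 3 * (2 * S.E₀ - (∫ x in (0:ℝ)..1, S.v x 0) ^ 2)) - 12

end NSSol

/-- The mean of a positive continuous function satisfies Jensen's inequality for the logarithm. -/
theorem integral_log_le_log_integral {f : ℝ → ℝ} (hf : ContinuousOn f (Icc 0 1))
    (hpos : ∀ x ∈ Icc (0:ℝ) 1, 0 < f x) :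
    0 < (∫ x in (0:ℝ)..1, f x) ∧
      (∫ x in (0:ℝ)..1, Real.log (f x)) ≤ Real.log (∫ x in (0:ℝ)..1, f x) := by
  have hint : IntervalIntegrable f volume 0 1 :=
    hf.intervalIntegrable_of_Icc zero_le_one
  have hlog : IntervalIntegrable (fun x => Real.log (f x)) volume 0 1 :=
    (hf.log fun x hx => (hpos x hx).ne').intervalIntegrable_of_Icc zero_le_one
  have hm : 0 < ∫ x in (0:ℝ)..1, f x :=
    intervalIntegral.intervalIntegral_pos_of_pos_on hint
      (fun x hx => hpos x (Ioo_subset_Icc_self hx)) one_pos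
  refine ⟨hm, ?_⟩
  set m := ∫ x in (0:ℝ)..1, f x with hm_def
  have htangent : ∀ x ∈ Icc (0:ℝ) 1, Real.log (f x) ≤ f x / m + (Real.log m - 1) := by
    intro x hx
    have h := Real.log_le_sub_one_of_pos (div_pos (hpos x hx) hm)
    rw [Real.log_div (hpos x hx).ne' hm.ne'] at h
    linarith
  calc ∫ x in (0:ℝ)..1, Real.log (f x)
      ≤ ∫ x in (0:ℝ)..1, (f x / m + (Real.log m - 1)) :=
        intervalIntegral.integral_mono_on zero_le_one hlog
          ((hint.div_const m).add intervalIntegrable_const) htangent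
    _ = Real.log m := by
        rw [intervalIntegral.integral_add (hint.div_const m) intervalIntegrable_const,
          intervalIntegral.integral_div, ← hm_def, div_self hm.ne']
        simp

/-- The convex function `x - log x - 1` increases strictly away from its minimum at `1`. -/
theorem sub_log_sub_one_lt {a m : ℝ} (ha : 0 < a) (hm : 0 < m) (hne : m ≠ a)
    (hside : 0 ≤ (m - a) * (a - 1)) :
    a - Real.log a - 1 < m - Real.log m - 1 := by
  have h := Real.log_lt_sub_one_of_pos (div_pos hm ha) (by rwa [Ne, div_eq_one_iff_eq ha.ne'])
  rw [Real.log_div hm.ne' ha.ne'] at h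
  have hdiv : m / a - 1 ≤ m - a := by
    rw [sub_le_iff_le_add, div_le_iff₀ ha]
    linarith
  linarith

theorem NSSol.V_nonneg (S : NSSol) {t : ℝ} (ht : t ∈ Ici (0:ℝ)) : 0 ≤ S.V t := by
  refine intervalIntegral.integral_nonneg zero_le_one fun x hx => ?_
  have hu := S.hu_pos x hx t ht
  have hθ := S.hθ_pos x hx t ht
  positivity

/-- Two-sided bounds on the mean temperature by the roots `α₁ ≤ 1 ≤ α₂`
of `x − log x − 1 = e₀`. -/
theorem mean_temperature_bounds (S : NSSol) (e₀ α₁ α₂ : ℝ)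
    (he₀ : 0 < e₀)
    (hbound : ∀ T ∈ Ici (0:ℝ),
      (∫ x in (0:ℝ)..1,
          ((S.v x T) ^ 2 / 2 + (S.θ x T - Real.log (S.θ x T) - 1)))
        + (∫ s in (0:ℝ)..T, S.V s) ≤ e₀)
    (hα₁_pos : 0 < α₁) (hα₁_le : α₁ ≤ 1) (hα₂_ge : 1 ≤ α₂)
    (hα₁_root : α₁ - Real.log α₁ - 1 = e₀)
    (hα₂_root : α₂ - Real.log α₂ - 1 = e₀) :
    ∀ t ∈ Ici (0:ℝ),
      α₁ ≤ (∫ x in (0:ℝ)..1, S.θ x t) ∧ (∫ x in (0:ℝ)..1, S.θ x t) ≤ α₂ := by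
  intro t ht
  have slice : ContinuousOn (fun x : ℝ => (x, t)) (Icc 0 1) := by fun_prop
  have hmaps : MapsTo (fun x : ℝ => (x, t)) (Icc 0 1) (Icc 0 1 ×ˢ Ici 0) :=
    fun x hx => ⟨hx, ht⟩
  have hθ : ContinuousOn (fun x => S.θ x t) (Icc 0 1) := S.hθ_cont.comp slice hmaps
  have hv : ContinuousOn (fun x => S.v x t) (Icc 0 1) := S.hv_cont.comp slice hmaps
  have hθ_pos : ∀ x ∈ Icc (0:ℝ) 1, 0 < S.θ x t := fun x hx => S.hθ_pos x hx t ht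
  obtain ⟨hm, hjensen⟩ := integral_log_le_log_integral hθ hθ_pos
  have hθ_int : IntervalIntegrable (fun x => S.θ x t) volume 0 1 :=
    hθ.intervalIntegrable_of_Icc zero_le_one
  have hlog_int : IntervalIntegrable (fun x => Real.log (S.θ x t)) volume 0 1 :=
    (hθ.log fun x hx => (hθ_pos x hx).ne').intervalIntegrable_of_Icc zero_le_one
  have hv_int : IntervalIntegrable (fun x => S.v x t ^ 2 / 2) volume 0 1 :=
    ((hv.pow 2).div_const 2).intervalIntegrable_of_Icc zero_le_one
  have hkinetic : 0 ≤ ∫ x in (0:ℝ)..1, S.v x t ^ 2 / 2 :=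
    intervalIntegral.integral_nonneg zero_le_one fun x _ => by positivity
  have hdissipation : 0 ≤ ∫ s in (0:ℝ)..t, S.V s :=
    intervalIntegral.integral_nonneg ht fun s hs => S.V_nonneg hs.1
  have hentropy := hbound t ht
  rw [intervalIntegral.integral_add hv_int
      ((hθ_int.sub hlog_int).sub intervalIntegrable_const),
    intervalIntegral.integral_sub (hθ_int.sub hlog_int) intervalIntegrable_const,
    intervalIntegral.integral_sub hθ_int hlog_int, intervalIntegral.integral_const] at hentropy
  simp only [sub_zero, one_smul] at hentropy
  constructor
  · by_contra! hlt
    have := sub_log_sub_one_lt hα₁_pos hm hlt.ne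
      (mul_nonneg_of_nonpos_of_nonpos (by linarith) (by linarith))
    linarith
  · by_contra! hlt
    have := sub_log_sub_one_lt (by linarith) hm hlt.ne'
      (mul_nonneg (by linarith) (by linarith))
    linarith
end

section
/- For every t ≥ 0 and every x ∈ [0,1], the pointwise oscillation estimate holds: |θ(x,t)^{(β+1)/2} − (∫₀¹ θ(y,t) dy)^{(β+1)/2}| ≤ ((β+1)/2) · E₀^{1/2} · V(t)^{1/2} · (max_{y∈[0,1]} u(y,t))^{1/2}. -/
open MeasureTheory Real Set Filter Topology

theorem integral_eq_sub_of_hasDerivWithinAt_Icc {f f' : ℝ → ℝ} {a b : ℝ} (hab : a ≤ b)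
    (hf : ∀ x ∈ Icc a b, HasDerivWithinAt f (f' x) (Icc a b) x)
    (hf' : ContinuousOn f' (Icc a b)) :
    ∫ x in a..b, f' x = f b - f a :=
  intervalIntegral.integral_eq_sub_of_hasDerivAt_of_le hab
    (fun x hx => (hf x hx).continuousWithinAt)
    (fun x hx => (hf x (Ioo_subset_Icc_self hx)).hasDerivAt (Icc_mem_nhds hx.1 hx.2))
    (hf'.intervalIntegrable_of_Icc hab)

theorem abs_sub_le_integral_abs_deriv {f f' : ℝ → ℝ} {a b : ℝ}
    (hf : ∀ x ∈ Icc a b, HasDerivWithinAt f (f' x) (Icc a b) x)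
    (hf' : ContinuousOn f' (Icc a b)) {x y : ℝ} (hx : x ∈ Icc a b) (hy : y ∈ Icc a b) :
    |f x - f y| ≤ ∫ z in a..b, |f' z| := by
  wlog hyx : y ≤ x generalizing x y
  · rw [abs_sub_comm]
    exact this hy hx (le_of_not_ge hyx)
  have hsub : Icc y x ⊆ Icc a b := Icc_subset_Icc hy.1 hx.2
  rw [← integral_eq_sub_of_hasDerivWithinAt_Icc hyx
    (fun z hz => (hf z (hsub hz)).mono hsub) (hf'.mono hsub)]
  refine (intervalIntegral.abs_integral_le_integral_abs hyx).trans ?_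
  exact intervalIntegral.integral_mono_interval hy.1 hyx hx.2
    (Eventually.of_forall fun z => abs_nonneg _)
    (hf'.abs.intervalIntegrable_of_Icc (hy.1.trans (hyx.trans hx.2)))

theorem sq_integral_mul_le_of_continuousOn {f g : ℝ → ℝ} {a b : ℝ} (hab : a ≤ b)
    (hf : ContinuousOn f (Icc a b)) (hg : ContinuousOn g (Icc a b)) :
    (∫ x in a..b, f x * g x) ^ 2 ≤ (∫ x in a..b, f x ^ 2) * ∫ x in a..b, g x ^ 2 := by
  have hff : IntervalIntegrable (fun x => f x ^ 2) volume a b :=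
    (hf.pow 2).intervalIntegrable_of_Icc hab
  have hgg : IntervalIntegrable (fun x => g x ^ 2) volume a b :=
    (hg.pow 2).intervalIntegrable_of_Icc hab
  have hfg : IntervalIntegrable (fun x => f x * g x) volume a b :=
    (hf.mul hg).intervalIntegrable_of_Icc hab
  have key : ∀ s : ℝ, 0 ≤ (∫ x in a..b, f x ^ 2) * (s * s)
      + (2 * ∫ x in a..b, f x * g x) * s + ∫ x in a..b, g x ^ 2 := fun s => by
    have h0 : 0 ≤ ∫ x in a..b, (s * f x + g x) ^ 2 :=
      intervalIntegral.integral_nonneg hab fun x _ => sq_nonneg _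
    have h1 : ∫ x in a..b, (s * f x + g x) ^ 2
        = ∫ x in a..b, ((s * s) * f x ^ 2 + (2 * s) * (f x * g x) + g x ^ 2) :=
      intervalIntegral.integral_congr fun x _ => by ring
    rw [intervalIntegral.integral_add ((hff.const_mul _).add (hfg.const_mul _)) hgg,
      intervalIntegral.integral_add (hff.const_mul _) (hfg.const_mul _),
      intervalIntegral.integral_const_mul, intervalIntegral.integral_const_mul] at h1
    linarith
  have := discrim_le_zero key
  rw [discrim] at this
  linarith

theorem exists_eq_integral_zero_one {f : ℝ → ℝ} (hf : ContinuousOn f (Icc 0 1)) :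
    ∃ y ∈ Icc (0:ℝ) 1, f y = ∫ x in (0:ℝ)..1, f x := by
  have hint := hf.intervalIntegrable_of_Icc (μ := volume) zero_le_one
  obtain ⟨p, hp, hmin⟩ := isCompact_Icc.exists_isMinOn ⟨0, by simp⟩ hf
  obtain ⟨q, hq, hmax⟩ := isCompact_Icc.exists_isMaxOn ⟨0, by simp⟩ hf
  have h1 : f p ≤ ∫ x in (0:ℝ)..1, f x := by
    simpa using intervalIntegral.integral_mono_on zero_le_one
      (intervalIntegrable_const (c := f p)) hint fun x hx => hmin hx
  have h2 : ∫ x in (0:ℝ)..1, f x ≤ f q := by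
    simpa using intervalIntegral.integral_mono_on zero_le_one hint
      (intervalIntegrable_const (c := f q)) fun x hx => hmax hx
  exact isPreconnected_Icc.intermediate_value hp hq hf ⟨h1, h2⟩

namespace NSSol

theorem continuousOn_slice_space {f : ℝ → ℝ → ℝ}
    (hf : ContinuousOn (Function.uncurry f) (Icc 0 1 ×ˢ Ici 0)) {t : ℝ} (ht : t ∈ Ici (0:ℝ)) :
    ContinuousOn (fun y => f y t) (Icc 0 1) :=
  hf.comp (f := fun y => (y, t)) (by fun_prop) fun _ hy => ⟨hy, ht⟩

theorem continuousOn_slice_time {f : ℝ → ℝ → ℝ}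
    (hf : ContinuousOn (Function.uncurry f) (Icc 0 1 ×ˢ Ici 0)) {x : ℝ} (hx : x ∈ Icc (0:ℝ) 1) :
    ContinuousOn (fun s => f x s) (Ici 0) :=
  hf.comp (f := fun s => (x, s)) (by fun_prop) fun _ hs => ⟨hx, hs⟩

theorem integral_energy_rate_eq_zero (S : NSSol) {t : ℝ} (ht : t ∈ Ici (0:ℝ)) :
    ∫ x in (0:ℝ)..1, (S.v x t * S.vt x t + S.θt x t) = 0 := by
  have hd : ∀ x ∈ Icc (0:ℝ) 1, HasDerivWithinAt
      (fun y => S.v y t * ((S.vx y t - S.θ y t) / S.u y t) + S.θ y t ^ S.β * S.θx y t / S.u y t)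
      (S.v x t * S.vt x t + S.θt x t) (Icc 0 1) x := fun x hx => by
    have hu := (S.hu_pos x hx t ht).ne'
    refine (((S.hvx x hx t ht).mul (S.momentum x hx t ht)).add
      (S.energyEq x hx t ht)).congr_deriv ?_
    field_simp
    ring
  rw [integral_eq_sub_of_hasDerivWithinAt_Icc zero_le_one hd
    (((continuousOn_slice_space S.hv_cont ht).mul (continuousOn_slice_space S.hvt_cont ht)).add
      (continuousOn_slice_space S.hθt_cont ht)),
    S.bc0 t ht, S.bc1 t ht, S.bcθ0 t ht, S.bcθ1 t ht]
  simp

theorem integral_energy_eq (S : NSSol) {t : ℝ} (ht : t ∈ Ici (0:ℝ)) :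
    ∫ x in (0:ℝ)..1, ((S.v x t) ^ 2 / 2 + S.θ x t) = S.E₀ := by
  have ht0 : (0:ℝ) ≤ t := ht
  have hc : ContinuousOn (Function.uncurry fun x s => S.v x s * S.vt x s + S.θt x s)
      (Icc 0 1 ×ˢ Ici 0) := (S.hv_cont.mul S.hvt_cont).add S.hθt_cont
  have he : ∀ s ∈ Ici (0:ℝ),
      IntervalIntegrable (fun x => (S.v x s) ^ 2 / 2 + S.θ x s) volume 0 1 := fun s hs =>
    ((((continuousOn_slice_space S.hv_cont hs).pow 2).div_const 2).add
      (continuousOn_slice_space S.hθ_cont hs)).intervalIntegrable_of_Icc zero_le_one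
  have htime : ∀ x ∈ Icc (0:ℝ) 1, ∫ s in (0:ℝ)..t, (S.v x s * S.vt x s + S.θt x s)
      = ((S.v x t) ^ 2 / 2 + S.θ x t) - ((S.v x 0) ^ 2 / 2 + S.θ x 0) := fun x hx => by
    refine integral_eq_sub_of_hasDerivWithinAt_Icc
      (f := fun s => (S.v x s) ^ 2 / 2 + S.θ x s) ht0 (fun s hs => ?_)
      ((continuousOn_slice_time hc hx).mono Icc_subset_Ici_self)
    refine HasDerivWithinAt.mono ?_ Icc_subset_Ici_self
    refine ((((S.hvt x hx s hs.1).pow 2).div_const 2).add (S.hθt x hx s hs.1)).congr_deriv ?_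
    norm_num
    ring
  have hint : Integrable (Function.uncurry fun x s => S.v x s * S.vt x s + S.θt x s)
      ((volume.restrict (uIoc 0 1)).prod (volume.restrict (Ioc 0 t))) := by
    rw [Measure.prod_restrict, uIoc_of_le zero_le_one]
    exact ((hc.mono (prod_mono_right Icc_subset_Ici_self)).integrableOn_compact
      (isCompact_Icc.prod isCompact_Icc)).mono_set
        (prod_mono Ioc_subset_Icc_self Ioc_subset_Icc_self)
  have hzero : ∫ x in (0:ℝ)..1, ∫ s in (0:ℝ)..t, (S.v x s * S.vt x s + S.θt x s) = 0 := by
    simp only [intervalIntegral.integral_of_le ht0]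
    rw [intervalIntegral_integral_swap hint]
    exact setIntegral_eq_zero_of_forall_eq_zero fun s hs =>
      S.integral_energy_rate_eq_zero hs.1.le
  rw [intervalIntegral.integral_congr fun x hx => htime x (by rwa [uIcc_of_le zero_le_one] at hx),
    intervalIntegral.integral_sub (he t ht) (he 0 self_mem_Ici)] at hzero
  exact sub_eq_zero.mp hzero

theorem integral_theta_le_energy (S : NSSol) {t : ℝ} (ht : t ∈ Ici (0:ℝ)) :
    ∫ x in (0:ℝ)..1, S.θ x t ≤ S.E₀ := by
  rw [← S.integral_energy_eq ht]
  have hv := continuousOn_slice_space S.hv_cont ht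
  have hθ := continuousOn_slice_space S.hθ_cont ht
  refine intervalIntegral.integral_mono_on zero_le_one (hθ.intervalIntegrable_of_Icc zero_le_one)
    ((((hv.pow 2).div_const 2).add hθ).intervalIntegrable_of_Icc zero_le_one) fun x _ => ?_
  have := sq_nonneg (S.v x t)
  linarith

end NSSol

/-- Pointwise oscillation estimate for `θ^{(β+1)/2}` around the mean temperature:
`|θ^{(β+1)/2} − (∫₀¹θ)^{(β+1)/2}| ≤ ((β+1)/2) E₀^{1/2} V(t)^{1/2} (max_{[0,1]} u)^{1/2}`. -/
theorem theta_oscillation_estimate (S : NSSol) :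
    ∀ t ∈ Ici (0:ℝ), ∀ x ∈ Icc (0:ℝ) 1,
      |S.θ x t ^ ((S.β + 1) / 2) - (∫ y in (0:ℝ)..1, S.θ y t) ^ ((S.β + 1) / 2)|
        ≤ ((S.β + 1) / 2) * Real.sqrt S.E₀ * Real.sqrt (S.V t)
          * Real.sqrt (sSup ((fun y => S.u y t) '' Icc (0:ℝ) 1)) := by
  intro t ht x hx
  have hβ := S.hβ
  have hu := NSSol.continuousOn_slice_space S.hu_cont ht
  have hθ := NSSol.continuousOn_slice_space S.hθ_cont ht
  have hθx := NSSol.continuousOn_slice_space S.hθx_cont ht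
  have hvx := NSSol.continuousOn_slice_space S.hvx_cont ht
  have hup : ∀ y ∈ Icc (0:ℝ) 1, 0 < S.u y t := fun y hy => S.hu_pos y hy t ht
  have hθp : ∀ y ∈ Icc (0:ℝ) 1, 0 < S.θ y t := fun y hy => S.hθ_pos y hy t ht
  set a : ℝ := (S.β + 1) / 2 with ha
  have ha0 : 0 < a := by positivity
  set M := sSup ((fun y => S.u y t) '' Icc (0:ℝ) 1) with hM
  have huM : ∀ y ∈ Icc (0:ℝ) 1, S.u y t ≤ M := fun y hy =>
    le_csSup (isCompact_Icc.bddAbove_image hu) (mem_image_of_mem _ hy)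
  have hM0 : 0 ≤ M := (hup x hx).le.trans (huM x hx)
  obtain ⟨y, hy, hyθ⟩ := exists_eq_integral_zero_one hθ
  rw [← hyθ]
  -- the factors of the Cauchy–Schwarz inequality
  let f : ℝ → ℝ := fun z => √(S.θ z t ^ S.β * S.θx z t ^ 2 / (S.u z t * S.θ z t ^ 2))
  let g : ℝ → ℝ := fun z => √(S.u z t * S.θ z t)
  have hpow : ∀ p : ℝ, ContinuousOn (fun z => S.θ z t ^ p) (Icc 0 1) := fun p =>
    hθ.rpow_const fun z hz => Or.inl (hθp z hz).ne'
  have hdiss₁ : ContinuousOn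
      (fun z => S.θ z t ^ S.β * S.θx z t ^ 2 / (S.u z t * S.θ z t ^ 2)) (Icc 0 1) :=
    ((hpow _).mul (hθx.pow 2)).div (hu.mul (hθ.pow 2)) fun z hz =>
      (mul_pos (hup z hz) (pow_pos (hθp z hz) 2)).ne'
  have hdiss₂ : ContinuousOn
      (fun z => (S.vx z t - S.θ z t) ^ 2 / (S.u z t * S.θ z t)) (Icc 0 1) :=
    ((hvx.sub hθ).pow 2).div (hu.mul hθ) fun z hz => (mul_pos (hup z hz) (hθp z hz)).ne'
  have hf : ContinuousOn f (Icc 0 1) := hdiss₁.sqrt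
  have hg : ContinuousOn g (Icc 0 1) := (hu.mul hθ).sqrt
  have hfV : ∫ z in (0:ℝ)..1, f z ^ 2 ≤ S.V t := by
    refine intervalIntegral.integral_mono_on zero_le_one
      ((hf.pow 2).intervalIntegrable_of_Icc zero_le_one)
      ((hdiss₁.add hdiss₂).intervalIntegrable_of_Icc zero_le_one) fun z hz => ?_
    have h1 := hup z hz
    have h2 := hθp z hz
    simp only [f]
    rw [Real.sq_sqrt (by positivity)]
    exact le_add_of_nonneg_right (by positivity)
  have hgE : ∫ z in (0:ℝ)..1, g z ^ 2 ≤ M * S.E₀ := by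
    refine le_trans ?_ (mul_le_mul_of_nonneg_left (S.integral_theta_le_energy ht) hM0)
    rw [← intervalIntegral.integral_const_mul]
    refine intervalIntegral.integral_mono_on zero_le_one
      ((hg.pow 2).intervalIntegrable_of_Icc zero_le_one)
      ((hθ.const_mul M).intervalIntegrable_of_Icc zero_le_one) fun z hz => ?_
    have h1 := hup z hz
    have h2 := hθp z hz
    simp only [g]
    rw [Real.sq_sqrt (by positivity)]
    exact mul_le_mul_of_nonneg_right (huM z hz) h2.le
  have hE0 : 0 ≤ S.E₀ :=
    (intervalIntegral.integral_nonneg zero_le_one fun z hz => (hθp z hz).le).trans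
      (S.integral_theta_le_energy ht)
  have hV0 : 0 ≤ S.V t :=
    (intervalIntegral.integral_nonneg zero_le_one fun z _ => sq_nonneg (f z)).trans hfV
  have hosc := abs_sub_le_integral_abs_deriv (f := fun z => S.θ z t ^ a)
    (f' := fun z => S.θx z t * a * S.θ z t ^ (a - 1))
    (fun z hz => (S.hθx z hz t ht).rpow_const (Or.inl (hθp z hz).ne'))
    ((hθx.mul_const a).mul (hpow _)) hx hy
  have habs : ∫ z in (0:ℝ)..1, |S.θx z t * a * S.θ z t ^ (a - 1)|
      = a * ∫ z in (0:ℝ)..1, f z * g z := by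
    rw [← intervalIntegral.integral_const_mul]
    refine intervalIntegral.integral_congr fun z hz => ?_
    rw [uIcc_of_le zero_le_one] at hz
    have h1 := hup z hz
    have h2 := hθp z hz
    have h3 : S.θ z t ^ S.β = (S.θ z t ^ (a - 1)) ^ 2 * S.θ z t := by
      rw [← Real.rpow_natCast, ← Real.rpow_mul h2.le, ← Real.rpow_add_one h2.ne']
      congr 1
      push_cast
      rw [ha]
      ring
    have h4 : f z * g z = |S.θx z t * S.θ z t ^ (a - 1)| := by
      simp only [f, g]
      rw [← Real.sqrt_mul (by positivity), ← Real.sqrt_sq_eq_abs, h3]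
      congr 1
      field_simp
    change |S.θx z t * a * S.θ z t ^ (a - 1)| = a * (f z * g z)
    rw [h4, mul_right_comm, abs_mul, abs_of_pos ha0, mul_comm]
  have hCS : ∫ z in (0:ℝ)..1, f z * g z ≤ √(S.V t * (M * S.E₀)) :=
    Real.le_sqrt_of_sq_le ((sq_integral_mul_le_of_continuousOn zero_le_one hf hg).trans
      (mul_le_mul hfV hgE (intervalIntegral.integral_nonneg zero_le_one fun z _ => sq_nonneg _) hV0))
  refine hosc.trans ?_
  rw [habs]
  refine (mul_le_mul_of_nonneg_left hCS ha0.le).trans_eq ?_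
  rw [Real.sqrt_mul hV0, Real.sqrt_mul hM0]
  ring
end

section
/- There exists a positive constant C depending only on β and the initial data (and not on T) such that for every T > 0: sup_{0≤t≤T} ∫₀¹ u_x(x,t)² dx + ∫₀ᵀ ∫₀¹ (θ_x²/θ)(x,t) dx dt ≤ C. -/
open MeasureTheory Real Set Filter Topology

/-- The space-time strip `[0,1] × [0,∞)`. -/
abbrev strip : Set (ℝ × ℝ) := Icc (0:ℝ) 1 ×ˢ Ici (0:ℝ)

section Calculus

variable {F G : ℝ → ℝ → ℝ} {f f' : ℝ → ℝ}

lemma continuousOn_slice_fst (hF : ContinuousOn (fun p : ℝ × ℝ => F p.1 p.2) strip)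
    {t : ℝ} (ht : 0 ≤ t) : ContinuousOn (fun x => F x t) (Icc 0 1) :=
  hF.comp (f := fun x : ℝ => (x, t)) (by fun_prop) fun _ hx => ⟨hx, ht⟩

lemma continuousOn_slice_snd (hF : ContinuousOn (fun p : ℝ × ℝ => F p.1 p.2) strip)
    {x : ℝ} (hx : x ∈ Icc (0:ℝ) 1) : ContinuousOn (fun t => F x t) (Ici 0) :=
  hF.comp (f := fun t : ℝ => (x, t)) (by fun_prop) fun _ ht => ⟨hx, ht⟩

lemma intervalIntegrable_of_Icc (hf : ContinuousOn f (Icc 0 1)) :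
    IntervalIntegrable f volume 0 1 :=
  ContinuousOn.intervalIntegrable (by rwa [uIcc_of_le zero_le_one])

lemma continuous_clamp (hF : ContinuousOn (fun p : ℝ × ℝ => F p.1 p.2) strip) :
    Continuous fun p : ℝ × ℝ => F (max 0 (min p.1 1)) (max p.2 0) := by
  have := hF.comp_continuous (f := fun p : ℝ × ℝ => (max 0 (min p.1 1), max p.2 0))
    (by fun_prop) fun p => ⟨⟨le_max_left _ _, max_le zero_le_one (min_le_right _ _)⟩,
      le_max_right p.2 0⟩
  exact this

lemma clamp_eq {x t : ℝ} (hx : x ∈ Icc (0:ℝ) 1) (ht : 0 ≤ t) :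
    F (max 0 (min x 1)) (max t 0) = F x t := by
  rw [min_eq_left hx.2, max_eq_right hx.1, max_eq_left ht]

lemma integral_clamp_eq {y t : ℝ} (hy : y ∈ Icc (0:ℝ) 1) (ht : 0 ≤ t) :
    ∫ x in (0:ℝ)..y, F (max 0 (min x 1)) (max t 0) = ∫ x in (0:ℝ)..y, F x t := by
  refine intervalIntegral.integral_congr fun x hx => ?_
  rw [uIcc_of_le hy.1] at hx
  exact clamp_eq ⟨hx.1, hx.2.trans hy.2⟩ ht

lemma continuousOn_primitive (hF : ContinuousOn (fun p : ℝ × ℝ => F p.1 p.2) strip) :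
    ContinuousOn (fun p : ℝ × ℝ => ∫ x in (0:ℝ)..p.1, F x p.2) strip := by
  have h : Continuous fun p : ℝ × ℝ =>
      ∫ x in (0:ℝ)..p.1, F (max 0 (min x 1)) (max p.2 0) := by
    refine intervalIntegral.continuous_parametric_intervalIntegral_of_continuous
      (f := fun (p : ℝ × ℝ) x => F (max 0 (min x 1)) (max p.2 0)) ?_ continuous_fst
    exact (continuous_clamp hF).comp (f := fun q : (ℝ × ℝ) × ℝ => (q.2, q.1.2)) (by fun_prop)
  refine h.continuousOn.congr fun p hp => ?_
  exact (integral_clamp_eq hp.1 hp.2).symm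

lemma continuousOn_integral (hF : ContinuousOn (fun p : ℝ × ℝ => F p.1 p.2) strip) :
    ContinuousOn (fun t => ∫ x in (0:ℝ)..1, F x t) (Ici 0) :=
  continuousOn_slice_snd (F := fun y t => ∫ x in (0:ℝ)..y, F x t)
    (continuousOn_primitive hF) (x := 1) (by simp)

/-- The fundamental theorem of calculus for one-sided derivatives. -/
lemma integral_eq_sub_of_within {s : Set ℝ} {a b : ℝ} (hab : a ≤ b) (hs : Icc a b ⊆ s)
    (hf : ∀ x ∈ s, HasDerivWithinAt f (f' x) s x) (hf' : ContinuousOn f' s) :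
    ∫ x in a..b, f' x = f b - f a := by
  refine intervalIntegral.integral_eq_sub_of_hasDerivAt_of_le hab
    (fun x hx => ((hf x (hs hx)).continuousWithinAt).mono hs) (fun x hx => ?_)
    (ContinuousOn.intervalIntegrable (by rw [uIcc_of_le hab]; exact hf'.mono hs))
  exact (hf x (hs (Ioo_subset_Icc_self hx))).hasDerivAt
    (mem_of_superset (Icc_mem_nhds hx.1 hx.2) hs)

lemma hasDerivWithinAt_primitive_Ici (hf : ContinuousOn f (Ici 0)) {t : ℝ} (ht : 0 ≤ t) :
    HasDerivWithinAt (fun T => ∫ s in (0:ℝ)..T, f s) (f t) (Ici 0) t := by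
  have hc : Continuous fun s => f (max s 0) :=
    hf.comp_continuous (by fun_prop) fun s => le_max_right s 0
  have h := (hc.integral_hasStrictDerivAt 0 t).hasDerivAt.hasDerivWithinAt (s := Ici 0)
  rw [max_eq_left ht] at h
  have key : ∀ T ∈ Ici (0:ℝ), ∫ s in (0:ℝ)..T, f s = ∫ s in (0:ℝ)..T, f (max s 0) := by
    intro T hT
    refine intervalIntegral.integral_congr fun s hs => ?_
    rw [uIcc_of_le hT] at hs
    simp only [max_eq_left hs.1]
  exact h.congr key (key t ht)

lemma hasDerivWithinAt_primitive_Icc (hf : ContinuousOn f (Icc 0 1)) {x : ℝ}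
    (hx : x ∈ Icc (0:ℝ) 1) :
    HasDerivWithinAt (fun y => ∫ s in (0:ℝ)..y, f s) (f x) (Icc 0 1) x := by
  have hc : Continuous fun s => f (max 0 (min s 1)) :=
    hf.comp_continuous (by fun_prop) fun s =>
      ⟨le_max_left _ _, max_le zero_le_one (min_le_right _ _)⟩
  have h := (hc.integral_hasStrictDerivAt 0 x).hasDerivAt.hasDerivWithinAt (s := Icc 0 1)
  rw [min_eq_left hx.2, max_eq_right hx.1] at h
  have key : ∀ y ∈ Icc (0:ℝ) 1,
      ∫ s in (0:ℝ)..y, f s = ∫ s in (0:ℝ)..y, f (max 0 (min s 1)) := by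
    intro y hy
    refine intervalIntegral.integral_congr fun s hs => ?_
    rw [uIcc_of_le hy.1] at hs
    simp only [min_eq_left (hs.2.trans hy.2), max_eq_right hs.1]
  exact h.congr key (key x hx)

lemma integral_swap_strip (hG : ContinuousOn (fun p : ℝ × ℝ => G p.1 p.2) strip)
    {y t : ℝ} (hy : y ∈ Icc (0:ℝ) 1) (ht : 0 ≤ t) :
    ∫ x in (0:ℝ)..y, ∫ s in (0:ℝ)..t, G x s = ∫ s in (0:ℝ)..t, ∫ x in (0:ℝ)..y, G x s := by
  apply MeasureTheory.intervalIntegral_intervalIntegral_swap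
  have hc : ContinuousOn (Function.uncurry G) (Icc (0:ℝ) y ×ˢ Icc (0:ℝ) t) :=
    hG.mono (prod_mono (Icc_subset_Icc_right hy.2) Icc_subset_Ici_self)
  have := hc.integrableOn_compact (isCompact_Icc.prod isCompact_Icc) (μ := volume)
  refine this.mono_set (prod_mono ?_ ?_)
  · rw [uIoc_of_le hy.1]; exact Ioc_subset_Icc_self
  · rw [uIoc_of_le ht]; exact Ioc_subset_Icc_self

/-- Differentiation under the integral sign on the strip. -/
lemma hasDerivWithinAt_integral (hG : ContinuousOn (fun p : ℝ × ℝ => G p.1 p.2) strip)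
    (hF : ContinuousOn (fun p : ℝ × ℝ => F p.1 p.2) strip)
    (hFG : ∀ x ∈ Icc (0:ℝ) 1, ∀ t ∈ Ici (0:ℝ),
      HasDerivWithinAt (fun s => F x s) (G x t) (Ici 0) t)
    {y t : ℝ} (hy : y ∈ Icc (0:ℝ) 1) (ht : 0 ≤ t) :
    HasDerivWithinAt (fun s => ∫ x in (0:ℝ)..y, F x s) (∫ x in (0:ℝ)..y, G x t) (Ici 0) t := by
  have hsub : uIcc 0 y ⊆ Icc (0:ℝ) 1 := by
    rw [uIcc_of_le hy.1]; exact Icc_subset_Icc_right hy.2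
  have hI : ∀ s, 0 ≤ s → IntervalIntegrable (fun x => F x s) volume 0 y := fun s hs =>
    ((continuousOn_slice_fst hF hs).mono hsub).intervalIntegrable
  have key : ∀ T ∈ Ici (0:ℝ), ∫ x in (0:ℝ)..y, F x T
      = (∫ x in (0:ℝ)..y, F x 0) + ∫ s in (0:ℝ)..T, ∫ x in (0:ℝ)..y, G x s := by
    intro T hT
    rw [← integral_swap_strip hG hy hT, ← sub_eq_iff_eq_add',
      ← intervalIntegral.integral_sub (hI T hT) (hI 0 le_rfl)]
    refine intervalIntegral.integral_congr fun x hx => ?_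
    exact (integral_eq_sub_of_within hT Icc_subset_Ici_self (hFG x (hsub hx))
      (continuousOn_slice_snd hG (hsub hx))).symm
  have hc : ContinuousOn (fun s => ∫ x in (0:ℝ)..y, G x s) (Ici 0) :=
    continuousOn_slice_snd (F := fun y t => ∫ x in (0:ℝ)..y, G x t)
      (continuousOn_primitive hG) hy
  exact ((hasDerivWithinAt_primitive_Ici hc ht).const_add _).congr key (key t ht)

/-- Equality of mixed partial derivatives: the spatial derivative of `F` is differentiable in
time when the time derivative of `F` is continuously differentiable in space. -/
lemma hasDerivWithinAt_mixed {Fx Gx : ℝ → ℝ → ℝ}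
    (hG : ContinuousOn (fun p : ℝ × ℝ => G p.1 p.2) strip)
    (hGx : ContinuousOn (fun p : ℝ × ℝ => Gx p.1 p.2) strip)
    (hFx : ∀ x ∈ Icc (0:ℝ) 1, ∀ t ∈ Ici (0:ℝ),
      HasDerivWithinAt (fun y => F y t) (Fx x t) (Icc 0 1) x)
    (hFG : ∀ x ∈ Icc (0:ℝ) 1, ∀ t ∈ Ici (0:ℝ),
      HasDerivWithinAt (fun s => F x s) (G x t) (Ici 0) t)
    (hGGx : ∀ x ∈ Icc (0:ℝ) 1, ∀ t ∈ Ici (0:ℝ),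
      HasDerivWithinAt (fun y => G y t) (Gx x t) (Icc 0 1) x)
    {x t : ℝ} (hx : x ∈ Icc (0:ℝ) 1) (ht : 0 ≤ t) :
    HasDerivWithinAt (fun s => Fx x s) (Gx x t) (Ici 0) t := by
  have h0 : (0:ℝ) ∈ Icc (0:ℝ) 1 := by simp
  have hcI : ∀ T, 0 ≤ T → ContinuousOn (fun y => ∫ s in (0:ℝ)..T, Gx y s) (Icc 0 1) := by
    intro T hT
    have h : Continuous fun y : ℝ => ∫ s in (0:ℝ)..T, Gx (max 0 (min y 1)) (max s 0) :=
      intervalIntegral.continuous_parametric_intervalIntegral_of_continuous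
        (f := fun (y : ℝ) s => Gx (max 0 (min y 1)) (max s 0)) (continuous_clamp hGx)
        continuous_const
    refine h.continuousOn.congr fun y hy => ?_
    refine intervalIntegral.integral_congr fun s hs => ?_
    rw [uIcc_of_le hT] at hs
    exact (clamp_eq hy hs.1).symm
  have key : ∀ T ∈ Ici (0:ℝ), Fx x T = Fx x 0 + ∫ s in (0:ℝ)..T, Gx x s := by
    intro T hT
    have e : ∀ y ∈ Icc (0:ℝ) 1, F y T - F y 0 =
        (∫ s in (0:ℝ)..T, G 0 s) + ∫ z in (0:ℝ)..y, ∫ s in (0:ℝ)..T, Gx z s := by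
      intro y hy
      have hsT : uIcc 0 T ⊆ Ici (0:ℝ) := by rw [uIcc_of_le hT]; exact Icc_subset_Ici_self
      rw [integral_swap_strip hGx hy hT, ← integral_eq_sub_of_within hT Icc_subset_Ici_self (hFG y hy)
        (continuousOn_slice_snd hG hy), ← sub_eq_iff_eq_add', ← intervalIntegral.integral_sub
        ((continuousOn_slice_snd hG hy).mono hsT).intervalIntegrable
        ((continuousOn_slice_snd hG h0).mono hsT).intervalIntegrable]
      refine intervalIntegral.integral_congr fun s hs => ?_
      exact (integral_eq_sub_of_within (f := fun y => G y s) hy.1 (Icc_subset_Icc_right hy.2)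
        (fun z hz => hGGx z hz s (hsT hs)) (continuousOn_slice_fst hGx (hsT hs))).symm
    have d1 := (hFx x hx T hT).sub (hFx x hx 0 self_mem_Ici)
    have d2 := ((hasDerivWithinAt_primitive_Icc (hcI T hT) hx).const_add
      (∫ s in (0:ℝ)..T, G 0 s)).congr e (e x hx)
    have := (uniqueDiffOn_Icc zero_lt_one x hx).eq_deriv _ d1 d2
    linarith
  exact ((hasDerivWithinAt_primitive_Ici (continuousOn_slice_snd hGx hx) ht).const_add _).congr
    key (key t ht)

lemma exists_eq_integral (hf : ContinuousOn f (Icc 0 1)) :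
    ∃ y ∈ Icc (0:ℝ) 1, f y = ∫ x in (0:ℝ)..1, f x := by
  obtain ⟨c, hc, h⟩ := exists_eq_interval_average (f := f) (a := 0) (b := 1) zero_ne_one
    (by rwa [uIcc_of_le zero_le_one])
  rw [uIoo_of_le zero_le_one] at hc
  exact ⟨c, Ioo_subset_Icc_self hc, by rw [h, interval_average_eq]; simp⟩

lemma integral_mono_Icc {g : ℝ → ℝ} (hf : ContinuousOn f (Icc 0 1))
    (hg : ContinuousOn g (Icc 0 1)) (h : ∀ x ∈ Icc (0:ℝ) 1, f x ≤ g x) :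
    ∫ x in (0:ℝ)..1, f x ≤ ∫ x in (0:ℝ)..1, g x :=
  intervalIntegral.integral_mono_on zero_le_one (intervalIntegrable_of_Icc hf)
    (intervalIntegrable_of_Icc hg) h

lemma integral_nonneg_Icc (h : ∀ x ∈ Icc (0:ℝ) 1, 0 ≤ f x) : 0 ≤ ∫ x in (0:ℝ)..1, f x :=
  intervalIntegral.integral_nonneg zero_le_one h

/-- Oscillation is controlled by the integral of the modulus of the derivative. -/
lemma abs_sub_le_integral_abs (hf : ∀ x ∈ Icc (0:ℝ) 1, HasDerivWithinAt f (f' x) (Icc 0 1) x)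
    (hf' : ContinuousOn f' (Icc 0 1)) {a b : ℝ} (ha : a ∈ Icc (0:ℝ) 1)
    (hb : b ∈ Icc (0:ℝ) 1) : |f b - f a| ≤ ∫ x in (0:ℝ)..1, |f' x| := by
  wlog hab : a ≤ b generalizing a b
  · rw [abs_sub_comm]; exact this hb ha (le_of_not_ge hab)
  rw [← integral_eq_sub_of_within hab (Icc_subset_Icc ha.1 hb.2) hf hf']
  refine (intervalIntegral.abs_integral_le_integral_abs hab).trans ?_
  exact intervalIntegral.integral_mono_interval ha.1 hab hb.2
    (Eventually.of_forall fun x => abs_nonneg _) (intervalIntegrable_of_Icc hf'.abs)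

/-- The Cauchy–Schwarz inequality in a form adapted to pointwise bounds `h² ≤ a b`. -/
lemma sq_integral_le_of_sq_le {h a b : ℝ → ℝ} (hh : ContinuousOn h (Icc 0 1))
    (ha : ContinuousOn a (Icc 0 1)) (hb : ContinuousOn b (Icc 0 1))
    (ha0 : ∀ x ∈ Icc (0:ℝ) 1, 0 ≤ a x) (hb0 : ∀ x ∈ Icc (0:ℝ) 1, 0 ≤ b x)
    (hle : ∀ x ∈ Icc (0:ℝ) 1, h x ^ 2 ≤ a x * b x) :
    (∫ x in (0:ℝ)..1, h x) ^ 2 ≤ (∫ x in (0:ℝ)..1, a x) * ∫ x in (0:ℝ)..1, b x := by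
  have key : ∀ s : ℝ, 0 ≤ (∫ x in (0:ℝ)..1, a x) * (s * s) + (2 * ∫ x in (0:ℝ)..1, h x) * s
      + ∫ x in (0:ℝ)..1, b x := by
    intro s
    have e : ∫ x in (0:ℝ)..1, (a x * (s * s) + 2 * h x * s + b x) =
        (∫ x in (0:ℝ)..1, a x) * (s * s) + (2 * ∫ x in (0:ℝ)..1, h x) * s
        + ∫ x in (0:ℝ)..1, b x := by
      rw [intervalIntegral.integral_add, intervalIntegral.integral_add,
        intervalIntegral.integral_mul_const, intervalIntegral.integral_mul_const,
        intervalIntegral.integral_const_mul]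
      all_goals apply intervalIntegrable_of_Icc; fun_prop
    rw [← e]
    refine integral_nonneg_Icc fun x hx => ?_
    have h1 := ha0 x hx
    have h2 := hb0 x hx
    have h3 := hle x hx
    rcases h1.eq_or_lt with h0 | h0
    · have : h x = 0 := by
        rw [← h0, zero_mul] at h3
        exact pow_eq_zero_iff (two_ne_zero) |>.1 (le_antisymm h3 (sq_nonneg _))
      rw [← h0, this]; simpa using h2
    · have : 0 ≤ a x * (a x * (s * s) + 2 * h x * s + b x) := by
        nlinarith [sq_nonneg (a x * s + h x)]
      exact nonneg_of_mul_nonneg_right this h0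
  have := discrim_le_zero key
  unfold discrim at this
  nlinarith

/-- A Grönwall inequality with an integrable rate and a dissipation term. -/
lemma gronwall_dissipation {φ φ' d k : ℝ → ℝ} {I : ℝ}
    (hφ : ∀ t ∈ Ici (0:ℝ), HasDerivWithinAt φ (φ' t) (Ici 0) t)
    (hd : ContinuousOn d (Ici 0)) (hk : ContinuousOn k (Ici 0))
    (hφ0 : ∀ t ∈ Ici (0:ℝ), 0 ≤ φ t) (hd0 : ∀ t ∈ Ici (0:ℝ), 0 ≤ d t)
    (hk0 : ∀ t ∈ Ici (0:ℝ), 0 ≤ k t) (hI : ∀ t ∈ Ici (0:ℝ), ∫ s in (0:ℝ)..t, k s ≤ I)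
    (hle : ∀ t ∈ Ici (0:ℝ), φ' t ≤ -d t + k t * (1 + φ t)) {T : ℝ} (hT : 0 ≤ T) :
    φ T + ∫ t in (0:ℝ)..T, d t ≤ (1 + φ 0) * exp I := by
  set K : ℝ → ℝ := fun t => ∫ s in (0:ℝ)..t, k s with hK
  set J : ℝ → ℝ := fun t => ∫ s in (0:ℝ)..t, d s with hJ
  have hJ0 : ∀ t ∈ Ici (0:ℝ), 0 ≤ J t := fun t ht =>
    intervalIntegral.integral_nonneg ht fun s hs => hd0 s hs.1
  have hder : ∀ t ∈ Ici (0:ℝ), HasDerivWithinAt (fun t => (1 + φ t + J t) * exp (-K t))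
      ((φ' t + d t) * exp (-K t) + (1 + φ t + J t) * (exp (-K t) * (-k t))) (Ici 0) t := by
    intro t ht
    exact (((hφ t ht).const_add 1).add (hasDerivWithinAt_primitive_Ici hd ht)).mul
      (hasDerivWithinAt_primitive_Ici hk ht).neg.exp
  have hanti : AntitoneOn (fun t => (1 + φ t + J t) * exp (-K t)) (Ici 0) := by
    refine antitoneOn_of_hasDerivWithinAt_nonpos (convex_Ici 0)
      (fun t ht => (hder t ht).continuousWithinAt)
      (fun t ht => (hder t (interior_subset ht)).mono interior_subset) fun t ht => ?_
    have ht' := interior_subset ht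
    have h1 := hle t ht'
    have h2 := mul_nonneg (hk0 t ht') (hJ0 t ht')
    have : (φ' t + d t) * exp (-K t) + (1 + φ t + J t) * (exp (-K t) * (-k t))
        = -(exp (-K t) * (k t * (1 + φ t + J t) - φ' t - d t)) := by ring
    rw [this]
    exact neg_nonpos.2 (mul_nonneg (exp_pos _).le (by nlinarith))
  have h := hanti (self_mem_Ici) hT hT
  have hK0 : K 0 = 0 := intervalIntegral.integral_same
  have hJ00 : J 0 = 0 := intervalIntegral.integral_same
  simp only [hK0, hJ00, neg_zero, exp_zero, mul_one, add_zero] at h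
  have h3 : 1 + φ T + J T ≤ (1 + φ 0) * exp (K T) := by
    have := mul_le_mul_of_nonneg_right h (exp_pos (K T)).le
    rwa [mul_assoc, ← exp_add, neg_add_cancel, exp_zero, mul_one] at this
  have h4 : (1 + φ 0) * exp (K T) ≤ (1 + φ 0) * exp I :=
    mul_le_mul_of_nonneg_left (exp_le_exp.2 (hI T hT)) (by linarith [hφ0 0 self_mem_Ici])
  linarith

end Calculus

namespace NSSol

variable (S : NSSol)

/-- The effective stress `(v_x − θ)/u`. -/
noncomputable def stress (x t : ℝ) : ℝ := (S.vx x t - S.θ x t) / S.u x t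

section Regularity

variable {S} {x t : ℝ}

lemma u_ne_zero : ∀ p ∈ strip, S.u p.1 p.2 ≠ 0 := fun p hp => (S.hu_pos p.1 hp.1 p.2 hp.2).ne'

lemma θ_ne_zero : ∀ p ∈ strip, S.θ p.1 p.2 ≠ 0 := fun p hp => (S.hθ_pos p.1 hp.1 p.2 hp.2).ne'

lemma continuousOn_u : ContinuousOn (fun p : ℝ × ℝ => S.u p.1 p.2) strip := S.hu_cont
lemma continuousOn_v : ContinuousOn (fun p : ℝ × ℝ => S.v p.1 p.2) strip := S.hv_cont
lemma continuousOn_θ : ContinuousOn (fun p : ℝ × ℝ => S.θ p.1 p.2) strip := S.hθ_cont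
lemma continuousOn_ux : ContinuousOn (fun p : ℝ × ℝ => S.ux p.1 p.2) strip := S.hux_cont
lemma continuousOn_ut : ContinuousOn (fun p : ℝ × ℝ => S.ut p.1 p.2) strip := S.hut_cont
lemma continuousOn_vx : ContinuousOn (fun p : ℝ × ℝ => S.vx p.1 p.2) strip := S.hvx_cont
lemma continuousOn_vt : ContinuousOn (fun p : ℝ × ℝ => S.vt p.1 p.2) strip := S.hvt_cont
lemma continuousOn_vxx : ContinuousOn (fun p : ℝ × ℝ => S.vxx p.1 p.2) strip := S.hvxx_cont
lemma continuousOn_θx : ContinuousOn (fun p : ℝ × ℝ => S.θx p.1 p.2) strip := S.hθx_cont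
lemma continuousOn_θt : ContinuousOn (fun p : ℝ × ℝ => S.θt p.1 p.2) strip := S.hθt_cont

lemma continuousOn_comp_θ {f : ℝ → ℝ} (hf : ContinuousOn f (Ioi 0)) :
    ContinuousOn (fun p : ℝ × ℝ => f (S.θ p.1 p.2)) strip :=
  hf.comp continuousOn_θ fun p hp => S.hθ_pos p.1 hp.1 p.2 hp.2

lemma continuousOn_rpow_θ (a : ℝ) :
    ContinuousOn (fun p : ℝ × ℝ => S.θ p.1 p.2 ^ a) strip :=
  continuousOn_θ.rpow_const fun p hp => Or.inl (θ_ne_zero p hp)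

lemma continuousOn_stress : ContinuousOn (fun p : ℝ × ℝ => S.stress p.1 p.2) strip :=
  (continuousOn_vx.sub continuousOn_θ).div continuousOn_u u_ne_zero

lemma u_mul_stress (hx : x ∈ Icc (0:ℝ) 1) (ht : 0 ≤ t) :
    S.u x t * S.stress x t = S.vx x t - S.θ x t := by
  have := (S.hu_pos x hx t ht).ne'
  unfold stress; field_simp

lemma vx_eq (hx : x ∈ Icc (0:ℝ) 1) (ht : 0 ≤ t) :
    S.vx x t = S.u x t * S.stress x t + S.θ x t := by
  rw [u_mul_stress hx ht]; ring

lemma hasDerivWithinAt_comp_θ {f f' : ℝ → ℝ} (hf : ∀ s > 0, HasDerivAt f (f' s) s)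
    (hx : x ∈ Icc (0:ℝ) 1) (ht : 0 ≤ t) :
    HasDerivWithinAt (fun y => f (S.θ y t)) (f' (S.θ x t) * S.θx x t) (Icc 0 1) x :=
  (hf _ (S.hθ_pos x hx t ht)).comp_hasDerivWithinAt x (S.hθx x hx t ht)

lemma hasDerivWithinAt_comp_θ_time {f f' : ℝ → ℝ} (hf : ∀ s > 0, HasDerivAt f (f' s) s)
    (hx : x ∈ Icc (0:ℝ) 1) (ht : 0 ≤ t) :
    HasDerivWithinAt (fun s => f (S.θ x s)) (f' (S.θ x t) * S.θt x t) (Ici 0) t :=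
  (hf _ (S.hθ_pos x hx t ht)).comp_hasDerivWithinAt t (S.hθt x hx t ht)

/-- The momentum equation tested against a function of space. -/
lemma integral_mul_vt {φ φ' : ℝ → ℝ}
    (hφ : ∀ x ∈ Icc (0:ℝ) 1, HasDerivWithinAt φ (φ' x) (Icc 0 1) x)
    (hφ' : ContinuousOn φ' (Icc 0 1)) (ht : 0 ≤ t) :
    ∫ x in (0:ℝ)..1, φ x * S.vt x t = -∫ x in (0:ℝ)..1, φ' x * S.stress x t := by
  have hφc : ContinuousOn φ (Icc 0 1) := fun x hx => (hφ x hx).continuousWithinAt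
  have h1 := continuousOn_slice_fst (S.continuousOn_vt) ht
  have h2 := continuousOn_slice_fst (S.continuousOn_stress) ht
  have h := integral_eq_sub_of_within (f := fun x => φ x * S.stress x t)
    (f' := fun x => φ' x * S.stress x t + φ x * S.vt x t) zero_le_one Subset.rfl
    (fun x hx => (hφ x hx).mul (S.momentum x hx t ht)) (by fun_prop)
  rw [intervalIntegral.integral_add (intervalIntegrable_of_Icc (by fun_prop))
    (intervalIntegrable_of_Icc (by fun_prop))] at h
  have e0 : S.stress 0 t = 0 := S.bc0 t ht
  have e1 : S.stress 1 t = 0 := S.bc1 t ht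
  simp only [e0, e1] at h
  linarith

/-- The temperature equation tested against a function of the temperature. -/
lemma integral_mul_θt {f f' : ℝ → ℝ} (hf : ∀ s > 0, HasDerivAt f (f' s) s)
    (hf' : ContinuousOn f' (Ioi 0)) (ht : 0 ≤ t) :
    ∫ x in (0:ℝ)..1, f (S.θ x t) * S.θt x t =
      (∫ x in (0:ℝ)..1, f (S.θ x t) * (S.stress x t * S.vx x t))
      - ∫ x in (0:ℝ)..1, f' (S.θ x t) * (S.θ x t ^ S.β * S.θx x t ^ 2 / S.u x t) := by
  have hfc : ContinuousOn f (Ioi 0) := fun s hs => (hf s hs).continuousAt.continuousWithinAt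
  have h1 := continuousOn_slice_fst (F := fun x t => f (S.θ x t)) (continuousOn_comp_θ hfc) ht
  have h2 := continuousOn_slice_fst (F := fun x t => f' (S.θ x t)) (continuousOn_comp_θ hf') ht
  have h3 := continuousOn_slice_fst (S.continuousOn_stress) ht
  have h4 := continuousOn_slice_fst (S.continuousOn_θx) ht
  have h5 := continuousOn_slice_fst (S.continuousOn_θt) ht
  have h6 := continuousOn_slice_fst (S.continuousOn_vx) ht
  have h7 := continuousOn_slice_fst (S.continuousOn_u) ht
  have h8 := continuousOn_slice_fst (F := fun x t => S.θ x t ^ S.β)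
    (S.continuousOn_rpow_θ S.β) ht
  have hu : ∀ x ∈ Icc (0:ℝ) 1, S.u x t ≠ 0 := fun x hx => (S.hu_pos x hx t ht).ne'
  have h9 : ContinuousOn (fun x => f' (S.θ x t) * (S.θ x t ^ S.β * S.θx x t ^ 2 / S.u x t))
      (Icc 0 1) := h2.mul ((h8.mul (h4.pow 2)).div h7 hu)
  have h10 : ContinuousOn (fun x => f (S.θ x t) * S.θt x t) (Icc 0 1) := h1.mul h5
  have h11 : ContinuousOn (fun x => f (S.θ x t) * (S.stress x t * S.vx x t)) (Icc 0 1) :=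
    h1.mul (h3.mul h6)
  have h12 : ContinuousOn (fun x => f (S.θ x t) * S.θt x t
      - f (S.θ x t) * (S.stress x t * S.vx x t)) (Icc 0 1) := h10.sub h11
  have h := integral_eq_sub_of_within (a := 0) (b := 1) (s := Icc (0:ℝ) 1)
    (f := fun x => f (S.θ x t) * (S.θ x t ^ S.β * S.θx x t / S.u x t))
    (f' := fun x => f (S.θ x t) * S.θt x t - f (S.θ x t) * (S.stress x t * S.vx x t)
      + f' (S.θ x t) * (S.θ x t ^ S.β * S.θx x t ^ 2 / S.u x t)) zero_le_one Subset.rfl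
    (fun x hx => by
      refine ((hasDerivWithinAt_comp_θ hf hx ht).mul (S.energyEq x hx t ht)).congr_deriv ?_
      have := hu x hx
      simp only [stress]
      field_simp
      ring) (h12.add h9)
  rw [intervalIntegral.integral_add (intervalIntegrable_of_Icc h12)
    (intervalIntegrable_of_Icc h9), intervalIntegral.integral_sub (intervalIntegrable_of_Icc h10)
    (intervalIntegrable_of_Icc h11), S.bcθ0 t ht, S.bcθ1 t ht] at h
  simp only [mul_zero, zero_div, sub_zero] at h
  linarith

end Regularity

section Conservation

variable {S} {t : ℝ}

lemma integral_v_eq (ht : 0 ≤ t) :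
    ∫ x in (0:ℝ)..1, S.v x t = ∫ x in (0:ℝ)..1, S.v x 0 := by
  have h1 : (1:ℝ) ∈ Icc (0:ℝ) 1 := by simp
  have h := integral_eq_sub_of_within (f := fun t => ∫ x in (0:ℝ)..1, S.v x t)
    (f' := fun t => ∫ x in (0:ℝ)..1, S.vt x t) ht Icc_subset_Ici_self
    (fun s hs => hasDerivWithinAt_integral S.continuousOn_vt S.continuousOn_v S.hvt h1 hs)
    (continuousOn_integral S.continuousOn_vt)
  have h0 : ∫ s in (0:ℝ)..t, ∫ x in (0:ℝ)..1, S.vt x s = 0 := by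
    rw [intervalIntegral.integral_congr (g := fun _ => (0:ℝ))]
    · simp
    · intro s hs
      rw [uIcc_of_le ht] at hs
      have := integral_mul_vt (S := S) (φ := fun _ => 1) (φ' := fun _ => 0)
        (fun x _ => hasDerivWithinAt_const ..) continuousOn_const hs.1
      simpa using this
  linarith

lemma energy_eq (ht : 0 ≤ t) :
    ∫ x in (0:ℝ)..1, (S.v x t ^ 2 / 2 + S.θ x t) = S.E₀ := by
  have h1 : (1:ℝ) ∈ Icc (0:ℝ) 1 := by simp
  have c1 := S.continuousOn_v
  have c2 := S.continuousOn_vt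
  have c3 := S.continuousOn_θ
  have c4 := S.continuousOn_θt
  have c5 : ContinuousOn (fun p : ℝ × ℝ => S.v p.1 p.2 * S.vt p.1 p.2 + S.θt p.1 p.2) strip := by
    fun_prop
  have c6 : ContinuousOn (fun p : ℝ × ℝ => S.v p.1 p.2 ^ 2 / 2 + S.θ p.1 p.2) strip := by
    fun_prop
  have h := integral_eq_sub_of_within (f := fun t => ∫ x in (0:ℝ)..1, (S.v x t ^ 2 / 2 + S.θ x t))
    (f' := fun t => ∫ x in (0:ℝ)..1, (S.v x t * S.vt x t + S.θt x t)) ht Icc_subset_Ici_self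
    (fun s hs => hasDerivWithinAt_integral (F := fun x t => S.v x t ^ 2 / 2 + S.θ x t)
      (G := fun x t => S.v x t * S.vt x t + S.θt x t) c5 c6 (fun x hx s hs => by
        refine ((((S.hvt x hx s hs).pow 2).div_const 2).add (S.hθt x hx s hs)).congr_deriv ?_
        norm_num; ring) h1 hs)
    (continuousOn_integral (F := fun x t => S.v x t * S.vt x t + S.θt x t) c5)
  have h0 : ∫ s in (0:ℝ)..t, ∫ x in (0:ℝ)..1, (S.v x s * S.vt x s + S.θt x s) = 0 := by
    rw [intervalIntegral.integral_congr (g := fun _ => (0:ℝ))]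
    · simp
    · intro s hs
      rw [uIcc_of_le ht] at hs
      have s1 := continuousOn_slice_fst c1 hs.1
      have s2 := continuousOn_slice_fst c2 hs.1
      have s3 := continuousOn_slice_fst c4 hs.1
      have e1 := integral_mul_vt (S := S) (φ := fun x => S.v x s) (φ' := fun x => S.vx x s)
        (fun x hx => S.hvx x hx s hs.1) (continuousOn_slice_fst S.continuousOn_vx hs.1) hs.1
      have e2 := integral_mul_θt (S := S) (f := fun _ => 1) (f' := fun _ => 0)
        (fun x _ => hasDerivAt_const ..) continuousOn_const hs.1
      simp only [one_mul, zero_mul, intervalIntegral.integral_zero, sub_zero] at e2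
      simp only [mul_comm (S.vx _ _)] at e1
      simp only
      rw [intervalIntegral.integral_add (intervalIntegrable_of_Icc (by fun_prop))
        (intervalIntegrable_of_Icc (by fun_prop)), e1, e2]
      ring
  unfold E₀
  linarith

lemma integral_θ_le (ht : 0 ≤ t) : ∫ x in (0:ℝ)..1, S.θ x t ≤ S.E₀ := by
  rw [← energy_eq ht]
  have s1 := continuousOn_slice_fst S.continuousOn_v ht
  have s2 := continuousOn_slice_fst S.continuousOn_θ ht
  exact integral_mono_Icc s2 (by fun_prop) fun x _ => by nlinarith [sq_nonneg (S.v x t)]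

lemma integral_v_sq_le (ht : 0 ≤ t) : ∫ x in (0:ℝ)..1, S.v x t ^ 2 ≤ 2 * S.E₀ := by
  rw [← energy_eq ht, ← intervalIntegral.integral_const_mul]
  have s1 := continuousOn_slice_fst S.continuousOn_v ht
  have s2 := continuousOn_slice_fst S.continuousOn_θ ht
  exact integral_mono_Icc (by fun_prop) (by fun_prop)
    fun x hx => by nlinarith [S.hθ_pos x hx t ht]

lemma E₀_nonneg : 0 ≤ S.E₀ :=
  (integral_nonneg_Icc fun x hx => (S.hθ_pos x hx 0 self_mem_Ici).le).trans
    (integral_θ_le le_rfl)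

lemma integral_abs_v_le (ht : 0 ≤ t) : ∫ x in (0:ℝ)..1, |S.v x t| ≤ 1 + 2 * S.E₀ := by
  have s1 := continuousOn_slice_fst S.continuousOn_v ht
  have : ∫ x in (0:ℝ)..1, |S.v x t| ≤ ∫ x in (0:ℝ)..1, (1 + S.v x t ^ 2) :=
    integral_mono_Icc (by fun_prop) (by fun_prop) fun x _ => by
      rw [← sq_abs]; nlinarith [sq_nonneg (|S.v x t| - 1)]
  rw [intervalIntegral.integral_add (intervalIntegrable_of_Icc (by fun_prop))
    (intervalIntegrable_of_Icc (by fun_prop))] at this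
  simp only [intervalIntegral.integral_const, sub_zero, smul_eq_mul, mul_one] at this
  linarith [integral_v_sq_le (S := S) ht]

lemma abs_primitive_v_le {x : ℝ} (hx : x ∈ Icc (0:ℝ) 1) (ht : 0 ≤ t) :
    |∫ y in (0:ℝ)..x, S.v y t| ≤ 1 + 2 * S.E₀ := by
  have s1 := continuousOn_slice_fst S.continuousOn_v ht
  refine (intervalIntegral.abs_integral_le_integral_abs hx.1).trans (le_trans ?_
    (integral_abs_v_le ht))
  exact intervalIntegral.integral_mono_interval le_rfl hx.1 hx.2
    (Eventually.of_forall fun x => abs_nonneg _) (intervalIntegrable_of_Icc s1.abs)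

end Conservation

section Entropy

variable {S} {t : ℝ}

variable (S) in
/-- The geometric mean `exp ∫ log θ` of the temperature. -/
noncomputable def geomMean (t : ℝ) : ℝ := exp (∫ x in (0:ℝ)..1, log (S.θ x t))

lemma continuousOn_V : ContinuousOn S.V (Ici 0) := by
  have c1 := S.continuousOn_u
  have c2 := S.continuousOn_θ
  have c3 := S.continuousOn_θx
  have c4 := S.continuousOn_vx
  have c5 := S.continuousOn_rpow_θ S.β
  have h1 : ∀ p ∈ strip, S.u p.1 p.2 * S.θ p.1 p.2 ^ 2 ≠ 0 := fun p hp =>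
    mul_ne_zero (u_ne_zero p hp) (pow_ne_zero 2 (θ_ne_zero p hp))
  have h2 : ∀ p ∈ strip, S.u p.1 p.2 * S.θ p.1 p.2 ≠ 0 := fun p hp =>
    mul_ne_zero (u_ne_zero p hp) (θ_ne_zero p hp)
  exact continuousOn_integral (F := fun x t =>
    S.θ x t ^ S.β * (S.θx x t) ^ 2 / (S.u x t * (S.θ x t) ^ 2)
      + (S.vx x t - S.θ x t) ^ 2 / (S.u x t * S.θ x t)) (by fun_prop (disch := assumption))

lemma continuousOn_heat_dissipation (ht : 0 ≤ t) :
    ContinuousOn (fun x => S.θ x t ^ S.β * S.θx x t ^ 2 / (S.u x t * S.θ x t ^ 2))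
      (Icc 0 1) := by
  have c1 := continuousOn_slice_fst S.continuousOn_u ht
  have c2 := continuousOn_slice_fst S.continuousOn_θ ht
  have c3 := continuousOn_slice_fst S.continuousOn_θx ht
  have c4 := continuousOn_slice_fst (F := fun x t => S.θ x t ^ S.β) (S.continuousOn_rpow_θ S.β) ht
  have h1 : ∀ x ∈ Icc (0:ℝ) 1, S.u x t * S.θ x t ^ 2 ≠ 0 := fun x hx =>
    mul_ne_zero (S.hu_pos x hx t ht).ne' (pow_ne_zero 2 (S.hθ_pos x hx t ht).ne')
  fun_prop (disch := assumption)

lemma continuousOn_viscous_dissipation (ht : 0 ≤ t) :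
    ContinuousOn (fun x => S.u x t * S.stress x t ^ 2 / S.θ x t) (Icc 0 1) := by
  have c1 := continuousOn_slice_fst S.continuousOn_u ht
  have c2 := continuousOn_slice_fst S.continuousOn_θ ht
  have c3 := continuousOn_slice_fst S.continuousOn_stress ht
  have h1 : ∀ x ∈ Icc (0:ℝ) 1, S.θ x t ≠ 0 := fun x hx => (S.hθ_pos x hx t ht).ne'
  fun_prop (disch := assumption)

lemma heat_dissipation_nonneg (ht : 0 ≤ t) : ∀ x ∈ Icc (0:ℝ) 1,
    0 ≤ S.θ x t ^ S.β * S.θx x t ^ 2 / (S.u x t * S.θ x t ^ 2) := fun x hx => by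
  have := S.hu_pos x hx t ht
  have := S.hθ_pos x hx t ht
  positivity

lemma viscous_dissipation_nonneg (ht : 0 ≤ t) : ∀ x ∈ Icc (0:ℝ) 1,
    0 ≤ S.u x t * S.stress x t ^ 2 / S.θ x t := fun x hx => by
  have := S.hu_pos x hx t ht
  have := S.hθ_pos x hx t ht
  positivity

lemma V_eq (ht : 0 ≤ t) : S.V t =
    (∫ x in (0:ℝ)..1, S.θ x t ^ S.β * S.θx x t ^ 2 / (S.u x t * S.θ x t ^ 2))
    + ∫ x in (0:ℝ)..1, S.u x t * S.stress x t ^ 2 / S.θ x t := by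
  rw [← intervalIntegral.integral_add (intervalIntegrable_of_Icc (continuousOn_heat_dissipation ht))
    (intervalIntegrable_of_Icc (continuousOn_viscous_dissipation ht))]
  refine intervalIntegral.integral_congr fun x hx => ?_
  rw [uIcc_of_le zero_le_one] at hx
  have := (S.hu_pos x hx t ht).ne'
  have := (S.hθ_pos x hx t ht).ne'
  simp only [stress]
  field_simp

lemma heat_dissipation_le_V (ht : 0 ≤ t) :
    ∫ x in (0:ℝ)..1, S.θ x t ^ S.β * S.θx x t ^ 2 / (S.u x t * S.θ x t ^ 2) ≤ S.V t := by
  rw [V_eq ht]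
  linarith [integral_nonneg_Icc (viscous_dissipation_nonneg (S := S) ht)]

lemma viscous_dissipation_le_V (ht : 0 ≤ t) :
    ∫ x in (0:ℝ)..1, S.u x t * S.stress x t ^ 2 / S.θ x t ≤ S.V t := by
  rw [V_eq ht]
  linarith [integral_nonneg_Icc (heat_dissipation_nonneg (S := S) ht)]

lemma V_nonneg_s8 (ht : 0 ≤ t) : 0 ≤ S.V t :=
  (integral_nonneg_Icc (viscous_dissipation_nonneg ht)).trans (viscous_dissipation_le_V ht)

lemma continuousOn_log_θ : ContinuousOn (fun p : ℝ × ℝ => log (S.θ p.1 p.2)) strip :=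
  continuousOn_θ.log θ_ne_zero

lemma hasDerivWithinAt_integral_log (ht : 0 ≤ t) :
    HasDerivWithinAt (fun s => ∫ x in (0:ℝ)..1, log (S.θ x s))
      (S.V t + ∫ x in (0:ℝ)..1, S.stress x t) (Ici 0) t := by
  have c1 := S.continuousOn_θ
  have c2 := S.continuousOn_θt
  have hθ := S.θ_ne_zero
  have h := hasDerivWithinAt_integral (F := fun x t => log (S.θ x t))
    (G := fun x t => (S.θ x t)⁻¹ * S.θt x t) (by fun_prop (disch := assumption))
    continuousOn_log_θ (fun x hx t ht => hasDerivWithinAt_comp_θ_time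
      (fun s hs => hasDerivAt_log (ne_of_gt hs)) hx ht) (y := 1) (by simp) ht
  refine h.congr_deriv ?_
  have e := integral_mul_θt (S := S) (f := fun s => s⁻¹) (f' := fun s => -(s ^ 2)⁻¹)
    (fun s hs => hasDerivAt_inv (ne_of_gt hs))
    (((continuousOn_id.pow 2).inv₀ fun s hs => pow_ne_zero 2 (ne_of_gt hs)).neg) ht
  have e1 : ∫ x in (0:ℝ)..1, (S.θ x t)⁻¹ * (S.stress x t * S.vx x t) =
      (∫ x in (0:ℝ)..1, S.u x t * S.stress x t ^ 2 / S.θ x t)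
        + ∫ x in (0:ℝ)..1, S.stress x t := by
    rw [← intervalIntegral.integral_add (intervalIntegrable_of_Icc
      (continuousOn_viscous_dissipation ht)) (intervalIntegrable_of_Icc
      (continuousOn_slice_fst S.continuousOn_stress ht))]
    refine intervalIntegral.integral_congr fun x hx => ?_
    rw [uIcc_of_le zero_le_one] at hx
    have := (S.hθ_pos x hx t ht).ne'
    simp only [vx_eq hx ht]
    field_simp
  have e2 : ∫ x in (0:ℝ)..1, -(S.θ x t ^ 2)⁻¹ * (S.θ x t ^ S.β * S.θx x t ^ 2 / S.u x t) =
      -∫ x in (0:ℝ)..1, S.θ x t ^ S.β * S.θx x t ^ 2 / (S.u x t * S.θ x t ^ 2) := by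
    rw [← intervalIntegral.integral_neg]
    refine intervalIntegral.integral_congr fun x hx => ?_
    rw [uIcc_of_le zero_le_one] at hx
    have := (S.hu_pos x hx t ht).ne'
    have := (S.hθ_pos x hx t ht).ne'
    field_simp
  rw [e, V_eq ht, e1, e2]
  ring

lemma hasDerivWithinAt_moment (ht : 0 ≤ t) :
    HasDerivWithinAt (fun s => ∫ x in (0:ℝ)..1, (1 - x) * S.v x s)
      (∫ x in (0:ℝ)..1, S.stress x t) (Ici 0) t := by
  have c1 := S.continuousOn_v
  have c2 := S.continuousOn_vt
  have h := hasDerivWithinAt_integral (F := fun x t => (1 - x) * S.v x t)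
    (G := fun x t => (1 - x) * S.vt x t) (by fun_prop) (by fun_prop)
    (fun x hx t ht => (S.hvt x hx t ht).const_mul (1 - x)) (y := 1) (by simp) ht
  refine h.congr_deriv ?_
  have := integral_mul_vt (S := S) (φ := fun x => 1 - x) (φ' := fun _ => -1)
    (fun x _ => ((hasDerivAt_id x).const_sub 1).hasDerivWithinAt) continuousOn_const ht
  simpa using this

lemma abs_moment_le (ht : 0 ≤ t) :
    |∫ x in (0:ℝ)..1, (1 - x) * S.v x t| ≤ 1 + 2 * S.E₀ := by
  have c1 := continuousOn_slice_fst S.continuousOn_v ht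
  refine (intervalIntegral.abs_integral_le_integral_abs zero_le_one).trans (le_trans ?_
    (integral_abs_v_le ht))
  refine integral_mono_Icc (by fun_prop) (by fun_prop) fun x hx => ?_
  rw [abs_mul, abs_of_nonneg (by linarith [hx.2])]
  exact mul_le_of_le_one_left (abs_nonneg _) (by linarith [hx.1])

lemma integral_log_θ_le (ht : 0 ≤ t) : ∫ x in (0:ℝ)..1, log (S.θ x t) ≤ S.E₀ :=
  (integral_mono_Icc (continuousOn_slice_fst (F := fun x t => log (S.θ x t)) continuousOn_log_θ ht)
    (continuousOn_slice_fst S.continuousOn_θ ht) fun x hx => log_le_self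
      (S.hθ_pos x hx t ht).le).trans (integral_θ_le ht)

lemma integral_V_eq (ht : 0 ≤ t) : ∫ s in (0:ℝ)..t, S.V s =
    ((∫ x in (0:ℝ)..1, log (S.θ x t)) - ∫ x in (0:ℝ)..1, (1 - x) * S.v x t)
    - ((∫ x in (0:ℝ)..1, log (S.θ x 0)) - ∫ x in (0:ℝ)..1, (1 - x) * S.v x 0) :=
  integral_eq_sub_of_within (f := fun t => (∫ x in (0:ℝ)..1, log (S.θ x t))
      - ∫ x in (0:ℝ)..1, (1 - x) * S.v x t) ht Icc_subset_Ici_self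
    (fun s hs => ((hasDerivWithinAt_integral_log hs).sub
      (hasDerivWithinAt_moment hs)).congr_deriv (by ring)) continuousOn_V

variable (S) in
lemma exists_integral_V_le : ∃ C, 0 ≤ C ∧ ∀ t ∈ Ici (0:ℝ), ∫ s in (0:ℝ)..t, S.V s ≤ C := by
  refine ⟨|S.E₀ + 2 * (1 + 2 * S.E₀) - ∫ x in (0:ℝ)..1, log (S.θ x 0)|, abs_nonneg _,
    fun t ht => le_trans ?_ (le_abs_self _)⟩
  rw [integral_V_eq ht]
  have h1 := abs_le.1 (abs_moment_le (S := S) ht)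
  have h2 := abs_le.1 (abs_moment_le (S := S) le_rfl)
  linarith [integral_log_θ_le (S := S) ht]

lemma integral_V_nonneg (ht : 0 ≤ t) : 0 ≤ ∫ s in (0:ℝ)..t, S.V s :=
  intervalIntegral.integral_nonneg ht fun _ hs => V_nonneg_s8 hs.1

lemma geomMean_pos : 0 < S.geomMean t := exp_pos _

variable (S) in
lemma exists_geomMean_bounds :
    ∃ c C : ℝ, 0 < c ∧ ∀ t ∈ Ici (0:ℝ), c ≤ S.geomMean t ∧ S.geomMean t ≤ C := by
  refine ⟨exp ((∫ x in (0:ℝ)..1, log (S.θ x 0)) - 2 * (1 + 2 * S.E₀)), exp S.E₀, exp_pos _,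
    fun t ht => ⟨exp_le_exp.2 ?_, exp_le_exp.2 (integral_log_θ_le ht)⟩⟩
  have h0 := integral_V_nonneg (S := S) ht
  rw [integral_V_eq ht] at h0
  have h1 := abs_le.1 (abs_moment_le (S := S) ht)
  have h2 := abs_le.1 (abs_moment_le (S := S) le_rfl)
  linarith

lemma hasDerivWithinAt_geomMean (ht : 0 ≤ t) :
    HasDerivWithinAt S.geomMean
      (S.geomMean t * (S.V t + ∫ x in (0:ℝ)..1, S.stress x t)) (Ici 0) t :=
  (hasDerivWithinAt_integral_log ht).exp

lemma exists_θ_eq_geomMean (ht : 0 ≤ t) : ∃ y ∈ Icc (0:ℝ) 1, S.θ y t = S.geomMean t := by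
  obtain ⟨y, hy, h⟩ := exists_eq_integral
    (continuousOn_slice_fst (F := fun x t => log (S.θ x t)) (S.continuousOn_log_θ) ht)
  exact ⟨y, hy, by rw [geomMean, ← h, exp_log (S.hθ_pos y hy t ht)]⟩

end Entropy

end NSSol

section Auxiliary

lemma hasDerivAt_integral_from_one {k : ℝ → ℝ} (hk : ContinuousOn k (Ioi 0)) {s : ℝ}
    (hs : 0 < s) : HasDerivAt (fun y => ∫ r in (1:ℝ)..y, k r) (k s) s := by
  have hsub : uIcc 1 s ⊆ Ioi (0:ℝ) := fun r hr => (lt_min one_pos hs).trans_le hr.1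
  refine intervalIntegral.integral_hasDerivAt_right (hk.mono hsub).intervalIntegrable ?_
    (hk.continuousAt (Ioi_mem_nhds hs))
  exact hk.stronglyMeasurableAtFilter isOpen_Ioi s hs

lemma nonneg_of_hasDerivWithinAt_of_max {f : ℝ → ℝ} {f' t : ℝ} (ht : 0 < t)
    (hf : HasDerivWithinAt f f' (Ici 0) t) (hmax : ∀ s ∈ Icc 0 t, f s ≤ f t) : 0 ≤ f' := by
  have h := (hf.mono (Ico_subset_Icc_self.trans Icc_subset_Ici_self : Ico 0 t ⊆ Ici 0))
  rw [hasDerivWithinAt_iff_tendsto_slope' (by simp)] at h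
  have : (𝓝[Ico 0 t] t).NeBot := by
    rw [nhdsWithin_Ico_eq_nhdsLT ht]; infer_instance
  refine ge_of_tendsto h (eventually_mem_nhdsWithin.mono fun s hs => ?_)
  rw [slope_def_field]
  exact div_nonneg_of_nonpos (by linarith [hmax s ⟨hs.1, hs.2.le⟩]) (by linarith [hs.2])

/-- A function on a space-time rectangle attains its maximum either initially or at a point where
its time derivative is nonnegative. -/
lemma exists_max_on_strip {Z Z' : ℝ → ℝ → ℝ}
    (hZ : ContinuousOn (fun p : ℝ × ℝ => Z p.1 p.2) strip)
    (hZ' : ∀ x ∈ Icc (0:ℝ) 1, ∀ t ∈ Ici (0:ℝ),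
      HasDerivWithinAt (fun s => Z x s) (Z' x t) (Ici 0) t) {T : ℝ} (hT : 0 ≤ T) :
    ∃ x ∈ Icc (0:ℝ) 1, ∃ t ∈ Ici (0:ℝ), (∀ y ∈ Icc (0:ℝ) 1, Z y t ≤ Z x t) ∧
      (∀ y ∈ Icc (0:ℝ) 1, Z y T ≤ Z x t) ∧ (t = 0 ∨ 0 ≤ Z' x t) := by
  obtain ⟨⟨x, t⟩, ⟨hx, ht⟩, hmax⟩ := ((isCompact_Icc (a := (0:ℝ)) (b := 1)).prod
    (isCompact_Icc (a := 0) (b := T))).exists_isMaxOn ⟨(0, 0), by simp [hT]⟩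
    (hZ.mono (prod_mono Subset.rfl Icc_subset_Ici_self))
  have hle : ∀ y ∈ Icc (0:ℝ) 1, ∀ s ∈ Icc 0 T, Z y s ≤ Z x t := fun y hy s hs =>
    hmax (show (y, s) ∈ Icc (0:ℝ) 1 ×ˢ Icc 0 T from ⟨hy, hs⟩)
  refine ⟨x, hx, t, ht.1, fun y hy => hle y hy t ht, fun y hy => hle y hy T ⟨hT, le_rfl⟩, ?_⟩
  rcases eq_or_lt_of_le ht.1 with h | h
  · exact Or.inl h.symm
  · exact Or.inr (nonneg_of_hasDerivWithinAt_of_max h (hZ' x hx t ht.1)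
      fun s hs => hle x hx s ⟨hs.1, hs.2.trans ht.2⟩)

end Auxiliary

namespace NSSol

variable {S : NSSol} {t : ℝ}

/-- Oscillation of a function of the temperature in terms of the dissipation. -/
lemma sq_sub_comp_θ_le {f f' : ℝ → ℝ} (hf : ∀ s > 0, HasDerivAt f (f' s) s)
    (hf' : ContinuousOn f' (Ioi 0)) (ht : 0 ≤ t) {W : ℝ}
    (hW : ∫ x in (0:ℝ)..1, S.u x t * f' (S.θ x t) ^ 2 * S.θ x t ^ 2 / S.θ x t ^ S.β ≤ W)
    {x y : ℝ} (hx : x ∈ Icc (0:ℝ) 1) (hy : y ∈ Icc (0:ℝ) 1) :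
    (f (S.θ x t) - f (S.θ y t)) ^ 2 ≤ W * S.V t := by
  have h1 := continuousOn_slice_fst S.continuousOn_u ht
  have h2 := continuousOn_slice_fst (F := fun x t => f' (S.θ x t)) (continuousOn_comp_θ hf') ht
  have h3 := continuousOn_slice_fst S.continuousOn_θ ht
  have h4 := continuousOn_slice_fst S.continuousOn_θx ht
  have h5 := continuousOn_slice_fst (F := fun x t => S.θ x t ^ S.β)
    (S.continuousOn_rpow_θ S.β) ht
  have hβ : ∀ x ∈ Icc (0:ℝ) 1, 0 < S.θ x t ^ S.β := fun x hx => rpow_pos_of_pos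
    (S.hθ_pos x hx t ht) _
  have hd : ContinuousOn (fun x => f' (S.θ x t) * S.θx x t) (Icc 0 1) := h2.mul h4
  have hb : ContinuousOn (fun x => S.u x t * f' (S.θ x t) ^ 2 * S.θ x t ^ 2 / S.θ x t ^ S.β)
      (Icc 0 1) := ((h1.mul (h2.pow 2)).mul (h3.pow 2)).div h5 fun x hx => (hβ x hx).ne'
  have hb0 : ∀ x ∈ Icc (0:ℝ) 1,
      0 ≤ S.u x t * f' (S.θ x t) ^ 2 * S.θ x t ^ 2 / S.θ x t ^ S.β := fun x hx => by
    have := S.hu_pos x hx t ht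
    have := hβ x hx
    positivity
  have hosc := abs_sub_le_integral_abs (f := fun x => f (S.θ x t))
    (fun x hx => hasDerivWithinAt_comp_θ hf hx ht) hd hy hx
  have hcs := sq_integral_le_of_sq_le hd.abs (continuousOn_heat_dissipation ht) hb
    (heat_dissipation_nonneg ht) hb0 fun x hx => by
      have h6 := (S.hu_pos x hx t ht).ne'
      have h7 := (S.hθ_pos x hx t ht).ne'
      have h8 := (hβ x hx).ne'
      rw [sq_abs]
      apply le_of_eq
      field_simp
  calc (f (S.θ x t) - f (S.θ y t)) ^ 2 = |f (S.θ x t) - f (S.θ y t)| ^ 2 := (sq_abs _).symm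
    _ ≤ (∫ x in (0:ℝ)..1, |f' (S.θ x t) * S.θx x t|) ^ 2 :=
      pow_le_pow_left₀ (abs_nonneg _) hosc 2
    _ ≤ _ := hcs
    _ ≤ S.V t * W := mul_le_mul (heat_dissipation_le_V ht) hW (integral_nonneg_Icc hb0)
      (V_nonneg_s8 ht)
    _ = W * S.V t := mul_comm _ _

lemma θ_le_of_u_le (ht : 0 ≤ t) {M : ℝ} (hM : ∀ x ∈ Icc (0:ℝ) 1, S.u x t ≤ M)
    {x : ℝ} (hx : x ∈ Icc (0:ℝ) 1) : S.θ x t ≤ 3 * (1 + S.E₀) * (1 + M * S.V t) := by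
  have hM0 : 0 ≤ M := (S.hu_pos x hx t ht).le.trans (hM x hx)
  have hE := E₀_nonneg (S := S)
  have hV := V_nonneg_s8 (S := S) ht
  set k : ℝ → ℝ := fun r => (√r)⁻¹ * min 1 (√(r ^ S.β)) with hk
  have hkc : ContinuousOn k (Ioi 0) := by
    refine (ContinuousOn.inv₀ continuous_sqrt.continuousOn fun r hr => (sqrt_pos.2 hr).ne').mul
      (continuousOn_const.inf (continuous_sqrt.comp_continuousOn
        (continuousOn_id.rpow_const fun r hr => Or.inl (ne_of_gt hr))))
  set f : ℝ → ℝ := fun s => ∫ r in (1:ℝ)..s, k r with hf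
  have hder : ∀ s > 0, HasDerivAt f (k s) s := fun s hs => hasDerivAt_integral_from_one hkc hs
  have hk0 : ∀ r, 0 ≤ k r := fun r => by simp only [hk]; positivity
  have hf1 : ∀ s, 1 ≤ s → f s = 2 * √s - 2 := by
    intro s hs
    have e : f s = ∫ r in (1:ℝ)..s, 2 * (1 / (2 * √r)) := by
      refine intervalIntegral.integral_congr fun r hr => ?_
      rw [uIcc_of_le hs] at hr
      have : 1 ≤ √(r ^ S.β) := one_le_sqrt.2 (one_le_rpow hr.1 S.hβ.le)
      simp only [hk, min_eq_left this]
      ring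
    rw [e, integral_eq_sub_of_within (f := fun r => 2 * √r) (s := Ici 1) hs Icc_subset_Ici_self]
    · simp
    · intro r hr
      exact ((hasDerivAt_sqrt (by linarith [mem_Ici.1 hr])).const_mul 2).hasDerivWithinAt
    · refine continuousOn_const.mul (continuousOn_const.div
        (continuousOn_const.mul continuous_sqrt.continuousOn) fun r hr => ?_)
      have : 0 < √r := sqrt_pos.2 (by linarith [mem_Ici.1 hr])
      positivity
  have hf2 : ∀ s, s ≤ 1 → f s ≤ 0 := fun s hs => by
    simp only [hf]
    rw [intervalIntegral.integral_symm]
    exact neg_nonpos.2 (intervalIntegral.integral_nonneg hs fun r _ => hk0 r)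
  rcases le_total (S.θ x t) 1 with h1 | h1
  · have : 0 ≤ M * S.V t := by positivity
    nlinarith
  have c3 := continuousOn_slice_fst S.continuousOn_θ ht
  obtain ⟨y, hy, hyE⟩ := exists_eq_integral c3
  have hyE' : S.θ y t ≤ S.E₀ := hyE ▸ integral_θ_le ht
  have hW : ∫ x in (0:ℝ)..1, S.u x t * k (S.θ x t) ^ 2 * S.θ x t ^ 2 / S.θ x t ^ S.β
      ≤ M * S.E₀ := by
    calc _ ≤ ∫ x in (0:ℝ)..1, M * S.θ x t := by
          have h1 := continuousOn_slice_fst S.continuousOn_u ht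
          have h2 := continuousOn_slice_fst (F := fun x t => k (S.θ x t))
            (continuousOn_comp_θ hkc) ht
          have h5 := continuousOn_slice_fst (F := fun x t => S.θ x t ^ S.β)
            (S.continuousOn_rpow_θ S.β) ht
          refine integral_mono_Icc (((h1.mul (h2.pow 2)).mul (c3.pow 2)).div h5 fun x hx =>
            (rpow_pos_of_pos (S.hθ_pos x hx t ht) _).ne') (continuousOn_const.mul c3)
            fun x hx => ?_
          have hθ := S.hθ_pos x hx t ht
          have hu := S.hu_pos x hx t ht
          have hp := rpow_pos_of_pos hθ S.β
          have hm : min 1 √(S.θ x t ^ S.β) ^ 2 ≤ S.θ x t ^ S.β := by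
            calc _ ≤ √(S.θ x t ^ S.β) ^ 2 :=
                  pow_le_pow_left₀ (le_min zero_le_one (sqrt_nonneg _)) (min_le_right _ _) 2
              _ = _ := sq_sqrt hp.le
          rw [div_le_iff₀ hp]
          simp only [hk]
          rw [mul_pow, inv_pow, sq_sqrt hθ.le]
          have e : S.u x t * ((S.θ x t)⁻¹ * min 1 √(S.θ x t ^ S.β) ^ 2) * S.θ x t ^ 2
              = S.u x t * S.θ x t * min 1 √(S.θ x t ^ S.β) ^ 2 := by
            field_simp
          rw [e]
          exact mul_le_mul (mul_le_mul_of_nonneg_right (hM x hx) hθ.le) hm (sq_nonneg _)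
            (by positivity)
      _ = M * ∫ x in (0:ℝ)..1, S.θ x t := intervalIntegral.integral_const_mul _ _
      _ ≤ M * S.E₀ := mul_le_mul_of_nonneg_left (integral_θ_le ht) hM0
  have hosc := sq_sub_comp_θ_le hder hkc ht hW hx hy
  have hfy : f (S.θ y t) ≤ 2 * √S.E₀ := by
    rcases le_total (S.θ y t) 1 with h | h
    · exact (hf2 _ h).trans (by positivity)
    · rw [hf1 _ h]; linarith [sqrt_le_sqrt hyE']
  have hfx := hf1 _ h1
  have hs1 := sq_sqrt hE
  have hs2 := sq_sqrt (S.hθ_pos x hx t ht).le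
  have hs3 := sqrt_nonneg S.E₀
  have hs4 := sqrt_nonneg (S.θ x t)
  set D := f (S.θ x t) - f (S.θ y t) with hD
  have hb : √(S.θ x t) ≤ 1 + √S.E₀ + D / 2 := by linarith
  have hb2 : √(S.θ x t) ^ 2 ≤ 3 * (1 + √S.E₀ ^ 2 + (D / 2) ^ 2) := by
    have : √(S.θ x t) ^ 2 ≤ (1 + √S.E₀ + D / 2) ^ 2 := pow_le_pow_left₀ hs4 hb 2
    nlinarith [sq_nonneg (1 - √S.E₀), sq_nonneg (1 - D / 2), sq_nonneg (√S.E₀ - D / 2)]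
  rw [hs1, hs2] at hb2
  have : 0 ≤ M * S.V t := by positivity
  nlinarith

lemma hasDerivWithinAt_primitive_v {x : ℝ} (hx : x ∈ Icc (0:ℝ) 1) (ht : 0 ≤ t) :
    HasDerivWithinAt (fun s => ∫ y in (0:ℝ)..x, S.v y s) (S.stress x t) (Ici 0) t := by
  refine (hasDerivWithinAt_integral S.continuousOn_vt S.continuousOn_v S.hvt hx ht).congr_deriv ?_
  have := integral_eq_sub_of_within (f := fun y => S.stress y t) hx.1 (Icc_subset_Icc_right hx.2)
    (fun y hy => S.momentum y hy t ht) (continuousOn_slice_fst S.continuousOn_vt ht)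
  rw [this, show S.stress 0 t = 0 from S.bc0 t ht, sub_zero]

variable (S) in
/-- The specific volume with the stress and a multiple of the dissipation integrated out. -/
noncomputable def weightedVolume (K x t : ℝ) : ℝ :=
  S.u x t * exp (-(∫ y in (0:ℝ)..x, S.v y t) - K * ∫ s in (0:ℝ)..t, S.V s)

lemma continuousOn_weightedVolume (K : ℝ) :
    ContinuousOn (fun p : ℝ × ℝ => S.weightedVolume K p.1 p.2) strip := by
  have h : ContinuousOn (fun p : ℝ × ℝ => ∫ s in (0:ℝ)..p.2, S.V s) strip :=
    ContinuousOn.comp (g := fun t => ∫ s in (0:ℝ)..t, S.V s) (t := Ici 0)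
      (fun t ht => (hasDerivWithinAt_primitive_Ici continuousOn_V ht).continuousWithinAt)
      continuous_snd.continuousOn fun p hp => hp.2
  exact continuousOn_u.mul (((continuousOn_primitive S.continuousOn_v).neg.sub
    (continuousOn_const.mul h)).rexp)

lemma hasDerivWithinAt_weightedVolume (K : ℝ) {x : ℝ} (hx : x ∈ Icc (0:ℝ) 1) (ht : 0 ≤ t) :
    HasDerivWithinAt (fun s => S.weightedVolume K x s)
      (exp (-(∫ y in (0:ℝ)..x, S.v y t) - K * ∫ s in (0:ℝ)..t, S.V s)
        * (S.θ x t - S.u x t - K * S.V t * S.u x t)) (Ici 0) t := by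
  refine ((S.hut x hx t ht).mul (((hasDerivWithinAt_primitive_v hx ht).neg.sub
    ((hasDerivWithinAt_primitive_Ici continuousOn_V ht).const_mul K)).exp)).congr_deriv ?_
  have h1 := S.mass x hx t ht
  have h2 := vx_eq (S := S) hx ht
  rw [show S.ut x t = S.u x t * S.stress x t + S.θ x t - S.u x t by linarith]
  simp only [Pi.sub_apply, Pi.neg_apply]
  ring

variable (S) in
lemma exists_u_le : ∃ M > 0, ∀ x ∈ Icc (0:ℝ) 1, ∀ t ∈ Ici (0:ℝ), S.u x t ≤ M := by
  obtain ⟨I, hI0, hI⟩ := S.exists_integral_V_le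
  obtain ⟨x₀, hx₀, hmax⟩ := isCompact_Icc.exists_isMaxOn (nonempty_Icc.2 zero_le_one)
    (continuousOn_slice_fst S.continuousOn_u le_rfl)
  have hE := E₀_nonneg (S := S)
  set b := 1 + 2 * S.E₀ with hb
  set C₀ := 3 * (1 + S.E₀) with hC₀
  set K := C₀ * exp (2 * b) with hK
  have hK0 : 0 ≤ K := by positivity
  have hU0 := S.hu_pos x₀ hx₀ 0 self_mem_Ici
  set U := max C₀ (S.u x₀ 0) with hU
  have hU' : 0 < U := hU0.trans_le (le_max_right _ _)
  refine ⟨U * exp b * exp (b + K * I), by positivity, fun x hx T hT => ?_⟩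
  obtain ⟨y, hy, t, ht, h1, h2, h3⟩ := exists_max_on_strip (continuousOn_weightedVolume (S := S) K)
    (fun x hx t ht => hasDerivWithinAt_weightedVolume K hx ht) hT
  have hut : S.u y t ≤ U := by
    rcases h3 with rfl | h3
    · exact (hmax hy).trans (le_max_right _ _)
    · have h4 := nonneg_of_mul_nonneg_right h3 (exp_pos _)
      have hM : ∀ z ∈ Icc (0:ℝ) 1, S.u z t ≤ exp (2 * b) * S.u y t := by
        intro z hz
        have h5 := h1 z hz
        have hBz := abs_le.1 (abs_primitive_v_le (S := S) hz ht)
        have hBy := abs_le.1 (abs_primitive_v_le (S := S) hy ht)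
        unfold weightedVolume at h5
        rw [sub_eq_add_neg, exp_add, sub_eq_add_neg, exp_add, ← mul_assoc, ← mul_assoc] at h5
        have h6 := le_of_mul_le_mul_right h5 (exp_pos _)
        have h7 : S.u z t ≤ S.u y t * exp (-(∫ r in (0:ℝ)..y, S.v r t)
            + ∫ r in (0:ℝ)..z, S.v r t) := by
          have := mul_le_mul_of_nonneg_right h6 (exp_pos (∫ r in (0:ℝ)..z, S.v r t)).le
          rwa [mul_assoc, ← exp_add, neg_add_cancel, exp_zero, mul_one, mul_assoc,
            ← exp_add] at this
        refine h7.trans ?_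
        rw [mul_comm]
        exact mul_le_mul_of_nonneg_right (exp_le_exp.2 (by linarith)) (S.hu_pos y hy t ht).le
      have h5 := θ_le_of_u_le ht hM hy
      have : S.u y t ≤ C₀ := by
        rw [← hC₀] at h5
        have : C₀ * (1 + exp (2 * b) * S.u y t * S.V t) = C₀ + K * S.V t * S.u y t := by
          rw [hK]; ring
        linarith
      exact this.trans (le_max_left _ _)
  have h4 := h2 x hx
  have hBy := abs_le.1 (abs_primitive_v_le (S := S) hy ht)
  have hBx := abs_le.1 (abs_primitive_v_le (S := S) hx hT)
  have h5 : S.weightedVolume K y t ≤ U * exp b := by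
    refine mul_le_mul hut (exp_le_exp.2 ?_) (exp_pos _).le hU'.le
    have := mul_nonneg hK0 (integral_V_nonneg (S := S) ht)
    linarith
  have h6 : S.u x T = S.weightedVolume K x T *
      exp ((∫ y in (0:ℝ)..x, S.v y T) + K * ∫ s in (0:ℝ)..T, S.V s) := by
    rw [weightedVolume, mul_assoc, ← exp_add]
    ring_nf
    simp
  rw [h6]
  refine mul_le_mul (h4.trans h5) (exp_le_exp.2 ?_) (exp_pos _).le (by positivity)
  have := mul_le_mul_of_nonneg_left (hI T hT) hK0
  linarith

variable (S) in
lemma exists_θ_le : ∃ C > 0, ∀ x ∈ Icc (0:ℝ) 1, ∀ t ∈ Ici (0:ℝ), S.θ x t ≤ C * (1 + S.V t) := by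
  obtain ⟨M, hM, hu⟩ := S.exists_u_le
  have hE := E₀_nonneg (S := S)
  refine ⟨3 * (1 + S.E₀) * (1 + M), by positivity, fun x hx t ht => ?_⟩
  refine (θ_le_of_u_le ht (fun x hx => hu x hx t ht) hx).trans ?_
  rw [mul_assoc _ (1 + M)]
  refine mul_le_mul_of_nonneg_left ?_ (by positivity)
  nlinarith [V_nonneg_s8 (S := S) ht]

variable (S) in
/-- When the dissipation is small the temperature is bounded from above and below. -/
lemma exists_θ_bounds_of_V_le : ∃ δ c C : ℝ, 0 < δ ∧ 0 < c ∧ ∀ t ∈ Ici (0:ℝ), S.V t ≤ δ →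
    ∀ x ∈ Icc (0:ℝ) 1, c ≤ S.θ x t ∧ S.θ x t ≤ C := by
  obtain ⟨M, hM, hu⟩ := S.exists_u_le
  obtain ⟨C, hC, hθ⟩ := S.exists_θ_le
  obtain ⟨g₀, g₁, hg₀, hg⟩ := S.exists_geomMean_bounds
  have hβ := S.hβ
  set a := g₀ ^ (S.β / 2) with ha
  have ha0 : 0 < a := rpow_pos_of_pos hg₀ _
  set δ := a ^ 2 / (4 * (M * (S.β / 2) ^ 2)) with hδ
  have hδ0 : 0 < δ := by positivity
  refine ⟨δ, (a / 2) ^ (2 / S.β), C * (1 + δ), hδ0, by positivity, fun t ht hV x hx => ⟨?_, ?_⟩⟩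
  · obtain ⟨y, hy, hyg⟩ := exists_θ_eq_geomMean (S := S) ht
    have hf : ∀ s > 0, HasDerivAt (fun s : ℝ => s ^ (S.β / 2)) (S.β / 2 * s ^ (S.β / 2 - 1)) s :=
      fun s hs => hasDerivAt_rpow_const (Or.inl (ne_of_gt hs))
    have hf' : ContinuousOn (fun s : ℝ => S.β / 2 * s ^ (S.β / 2 - 1)) (Ioi 0) :=
      continuousOn_const.mul (continuousOn_id.rpow_const fun s hs => Or.inl (ne_of_gt hs))
    have hW : ∫ x in (0:ℝ)..1, S.u x t * (S.β / 2 * S.θ x t ^ (S.β / 2 - 1)) ^ 2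
        * S.θ x t ^ 2 / S.θ x t ^ S.β ≤ M * (S.β / 2) ^ 2 := by
      have e : ∫ x in (0:ℝ)..1, S.u x t * (S.β / 2 * S.θ x t ^ (S.β / 2 - 1)) ^ 2
          * S.θ x t ^ 2 / S.θ x t ^ S.β = ∫ x in (0:ℝ)..1, S.u x t * (S.β / 2) ^ 2 := by
        refine intervalIntegral.integral_congr fun x hx => ?_
        rw [uIcc_of_le zero_le_one] at hx
        have h0 := S.hθ_pos x hx t ht
        have h1 : (S.θ x t ^ (S.β / 2 - 1)) ^ 2 * S.θ x t ^ 2 = S.θ x t ^ S.β := by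
          rw [← mul_pow, ← rpow_add_one h0.ne', sub_add_cancel, ← rpow_natCast, ← rpow_mul h0.le]
          norm_num
        have h2 := (rpow_pos_of_pos h0 S.β).ne'
        rw [div_eq_iff h2, ← h1]
        ring
      rw [e]
      have := integral_mono_Icc (f := fun x => S.u x t * (S.β / 2) ^ 2)
        (g := fun _ => M * (S.β / 2) ^ 2)
        ((continuousOn_slice_fst S.continuousOn_u ht).mul continuousOn_const)
        continuousOn_const fun x hx => mul_le_mul_of_nonneg_right (hu x hx t ht) (sq_nonneg _)
      simpa using this
    have h := sq_sub_comp_θ_le hf hf' ht hW hx hy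
    simp only [hyg] at h
    have h1 : a ≤ S.geomMean t ^ (S.β / 2) := rpow_le_rpow hg₀.le (hg t ht).1 (by positivity)
    have h2 : M * (S.β / 2) ^ 2 * S.V t ≤ (a / 2) ^ 2 := by
      calc _ ≤ M * (S.β / 2) ^ 2 * δ := mul_le_mul_of_nonneg_left hV (by positivity)
        _ = (a / 2) ^ 2 := by rw [hδ]; field_simp; norm_num
    have h3 := abs_le.1 (abs_le_of_sq_le_sq (h.trans h2) (by positivity))
    have h4 : a / 2 ≤ S.θ x t ^ (S.β / 2) := by linarith
    have h5 := rpow_le_rpow (by positivity) h4 (by positivity : 0 ≤ 2 / S.β)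
    rwa [← rpow_mul (S.hθ_pos x hx t ht).le, div_mul_div_cancel₀' (by positivity),
      div_self two_ne_zero, rpow_one] at h5
  · exact (hθ x hx t ht).trans (mul_le_mul_of_nonneg_left (by linarith) hC.le)

/-- When the dissipation is small it controls the distance to the geometric mean. -/
lemma exists_sq_sub_geomMean_le {δ c C : ℝ} (hc : 0 < c)
    (hδ : ∀ t ∈ Ici (0:ℝ), S.V t ≤ δ → ∀ x ∈ Icc (0:ℝ) 1, c ≤ S.θ x t ∧ S.θ x t ≤ C)
    {f f' : ℝ → ℝ} (hf : ∀ s > 0, HasDerivAt f (f' s) s) (hf' : ContinuousOn f' (Ioi 0)) :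
    ∃ A, 0 ≤ A ∧ ∀ t ∈ Ici (0:ℝ), S.V t ≤ δ → ∀ x ∈ Icc (0:ℝ) 1,
      (f (S.θ x t) - f (S.geomMean t)) ^ 2 ≤ A * S.V t := by
  obtain ⟨M, hM, hu⟩ := S.exists_u_le
  have hsub : Icc c C ⊆ Ioi 0 := fun s hs => hc.trans_le hs.1
  have hcont : ContinuousOn (fun s : ℝ => f' s ^ 2 * s ^ 2 / s ^ S.β) (Icc c C) := by
    refine (((hf'.mono hsub).pow 2).mul (continuousOn_id.pow 2)).div
      (continuousOn_id.rpow_const fun s hs => Or.inl (ne_of_gt (hsub hs))) fun s hs =>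
        (rpow_pos_of_pos (hsub hs) _).ne'
  obtain ⟨B, hB⟩ := isCompact_Icc.bddAbove_image hcont
  refine ⟨M * max B 0, by positivity, fun t ht hV x hx => ?_⟩
  obtain ⟨y, hy, hyg⟩ := exists_θ_eq_geomMean (S := S) ht
  rw [← hyg]
  refine sq_sub_comp_θ_le hf hf' ht ?_ hx hy
  have h1 := continuousOn_slice_fst S.continuousOn_u ht
  have h2 := continuousOn_slice_fst (F := fun x t => f' (S.θ x t)) (continuousOn_comp_θ hf') ht
  have h3 := continuousOn_slice_fst S.continuousOn_θ ht
  have h5 := continuousOn_slice_fst (F := fun x t => S.θ x t ^ S.β)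
    (S.continuousOn_rpow_θ S.β) ht
  have := integral_mono_Icc (f := fun x => S.u x t * f' (S.θ x t) ^ 2 * S.θ x t ^ 2
      / S.θ x t ^ S.β) (g := fun _ => M * max B 0)
    (((h1.mul (h2.pow 2)).mul (h3.pow 2)).div h5 fun x hx =>
      (rpow_pos_of_pos (S.hθ_pos x hx t ht) _).ne') continuousOn_const fun x hx => by
      have h0 := S.hθ_pos x hx t ht
      have hp := rpow_pos_of_pos h0 S.β
      rw [mul_assoc, mul_div_assoc]
      exact mul_le_mul (hu x hx t ht)
        ((hB ⟨_, hδ t ht hV x hx, rfl⟩).trans (le_max_left _ _)) (by positivity) hM.le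
  simpa using this

variable (S) in
lemma exists_le_u : ∃ m > 0, ∀ x ∈ Icc (0:ℝ) 1, ∀ t ∈ Ici (0:ℝ), m ≤ S.u x t := by
  obtain ⟨I, hI0, hI⟩ := S.exists_integral_V_le
  obtain ⟨δ, c, C, hδ, hc, hθ⟩ := S.exists_θ_bounds_of_V_le
  obtain ⟨x₀, hx₀, hmin⟩ := isCompact_Icc.exists_isMinOn (nonempty_Icc.2 zero_le_one)
    (continuousOn_slice_fst S.continuousOn_u le_rfl)
  set b := 1 + 2 * S.E₀ with hb
  have hU0 := S.hu_pos x₀ hx₀ 0 self_mem_Ici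
  set U := min c (S.u x₀ 0) with hU
  have hU' : 0 < U := lt_min hc hU0
  set K := δ⁻¹ with hK
  have hK0 : 0 < K := inv_pos.2 hδ
  refine ⟨U * exp (-b) * exp (-b - K * I), by positivity, fun x hx T hT => ?_⟩
  obtain ⟨y, hy, t, ht, -, h2, h3⟩ := exists_max_on_strip
    (continuousOn_weightedVolume (S := S) (-K)).neg
    (fun x hx t ht => (hasDerivWithinAt_weightedVolume (-K) hx ht).neg) hT
  have hut : U ≤ S.u y t := by
    rcases h3 with rfl | h3
    · exact (min_le_right _ _).trans (hmin hy)
    · have h4 : S.θ y t - S.u y t - -K * S.V t * S.u y t ≤ 0 := by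
        by_contra! h
        have := mul_pos (exp_pos (-(∫ z in (0:ℝ)..y, S.v z t) - -K * ∫ s in (0:ℝ)..t, S.V s)) h
        linarith
      have hu := S.hu_pos y hy t ht
      have hV := V_nonneg_s8 (S := S) ht
      refine (min_le_left _ _).trans ?_
      rcases le_total (S.V t) δ with h | h
      · have := (hθ t ht h y hy).1
        nlinarith [mul_nonneg (mul_nonneg hK0.le hV) hu.le]
      · have h5 : 1 ≤ K * S.V t := by
          rw [hK, ← div_eq_inv_mul, le_div_iff₀ hδ]; linarith
        nlinarith [S.hθ_pos y hy t ht]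
  have h4 := neg_le_neg_iff.1 (h2 x hx)
  have hBy := abs_le.1 (abs_primitive_v_le (S := S) hy ht)
  have hBx := abs_le.1 (abs_primitive_v_le (S := S) hx hT)
  have h5 : U * exp (-b) ≤ S.weightedVolume (-K) y t := by
    refine mul_le_mul hut (exp_le_exp.2 ?_) (exp_pos _).le (S.hu_pos y hy t ht).le
    have := mul_nonneg hK0.le (integral_V_nonneg (S := S) ht)
    linarith
  have h6 : S.u x T = S.weightedVolume (-K) x T *
      exp ((∫ y in (0:ℝ)..x, S.v y T) - K * ∫ s in (0:ℝ)..T, S.V s) := by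
    rw [weightedVolume, mul_assoc, ← exp_add]
    ring_nf
    simp
  rw [h6]
  refine mul_le_mul (h5.trans h4) (exp_le_exp.2 ?_) (exp_pos _).le
    ((mul_pos hU' (exp_pos _)).le.trans (h5.trans h4))
  have := mul_le_mul_of_nonneg_left (hI T hT) hK0.le
  linarith

section HeatFlux

variable (S)

/-- The primitive `∫₁ˢ r^(-β) dr`. -/
noncomputable def kirchhoff (s : ℝ) : ℝ := ∫ r in (1:ℝ)..s, r ^ (-S.β)

lemma continuousOn_rpow_const_Ioi (a : ℝ) : ContinuousOn (fun r : ℝ => r ^ a) (Ioi 0) :=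
  continuousOn_id.rpow_const fun _ hr => Or.inl (ne_of_gt hr)

lemma hasDerivAt_kirchhoff {s : ℝ} (hs : 0 < s) : HasDerivAt S.kirchhoff (s ^ (-S.β)) s :=
  hasDerivAt_integral_from_one (continuousOn_rpow_const_Ioi _) hs

lemma continuousOn_kirchhoff : ContinuousOn S.kirchhoff (Ioi 0) := fun _ hs =>
  (S.hasDerivAt_kirchhoff hs).continuousAt.continuousWithinAt

lemma uIcc_one_subset {s : ℝ} (hs : 0 < s) : uIcc 1 s ⊆ Ioi (0:ℝ) := fun _ hr =>
  (lt_min one_pos hs).trans_le hr.1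

lemma kirchhoff_le {s : ℝ} (hs : 0 < s) : S.kirchhoff s ≤ s - 1 := by
  have hi := ((continuousOn_rpow_const_Ioi (-S.β)).mono
    (uIcc_one_subset hs)).intervalIntegrable (μ := volume)
  rcases le_total 1 s with h | h
  · have := intervalIntegral.integral_mono_on h hi (intervalIntegrable_const (c := (1:ℝ)))
      fun r hr => rpow_le_one_of_one_le_of_nonpos hr.1 (neg_nonpos.2 S.hβ.le)
    simpa [kirchhoff] using this
  · have := intervalIntegral.integral_mono_on h (intervalIntegrable_const (c := (1:ℝ))) hi.symm
      fun r hr => one_le_rpow_of_pos_of_le_one_of_nonpos (hs.trans_le hr.1) hr.2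
        (neg_nonpos.2 S.hβ.le)
    rw [kirchhoff, intervalIntegral.integral_symm]
    simp at this
    linarith

lemma mul_rpow_neg_eq {s : ℝ} (hs : 0 < s) :
    s * s ^ (-S.β) = 1 + (1 - S.β) * S.kirchhoff s := by
  have h : ∫ r in (1:ℝ)..s, (1 - S.β) * r ^ (-S.β) = s ^ (1 - S.β) - 1 ^ (1 - S.β) := by
    refine intervalIntegral.integral_eq_sub_of_hasDerivAt (f := fun r => r ^ (1 - S.β))
      (f' := fun r => (1 - S.β) * r ^ (-S.β)) (fun r hr => ?_)
      ((continuousOn_const.mul (continuousOn_rpow_const_Ioi (-S.β))).mono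
        (uIcc_one_subset hs)).intervalIntegrable
    have := hasDerivAt_rpow_const (x := r) (p := 1 - S.β)
      (Or.inl (ne_of_gt (uIcc_one_subset hs hr)))
    rwa [show 1 - S.β - 1 = -S.β by ring] at this
  rw [intervalIntegral.integral_const_mul, one_rpow, sub_eq_add_neg, rpow_add hs, rpow_one] at h
  rw [kirchhoff, sub_eq_add_neg, h]
  ring

lemma sq_mul_rpow_neg_le {s L : ℝ} (hs : 0 < s) (hL : s ≤ L) :
    s ^ 2 * s ^ (-S.β) ≤ (L + S.β) * s + 1 - S.β * S.kirchhoff s := by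
  have hβ := S.hβ
  have h1 := S.kirchhoff_le hs
  rcases le_total 1 s with h | h
  · have : s ^ (-S.β) ≤ 1 := rpow_le_one_of_one_le_of_nonpos h (neg_nonpos.2 hβ.le)
    nlinarith [mul_le_mul_of_nonneg_left this (sq_nonneg s)]
  · have h2 := S.mul_rpow_neg_eq hs
    have h3 : 0 ≤ s * s ^ (-S.β) := by positivity
    nlinarith [mul_nonneg (hs.le.trans hL) hs.le, mul_pos hβ hs]

/-- The dissipation `∫ θ_x²/(uθ) dx`. -/
noncomputable def heatDissipation (t : ℝ) : ℝ :=
  ∫ x in (0:ℝ)..1, S.θx x t ^ 2 / (S.u x t * S.θ x t)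

/-- The entropy of the temperature distribution relative to its geometric mean. -/
noncomputable def relEntropy (t : ℝ) : ℝ :=
  S.kirchhoff (S.geomMean t) - ∫ x in (0:ℝ)..1, S.kirchhoff (S.θ x t)

variable {S}

lemma continuousOn_heatDissipation : ContinuousOn S.heatDissipation (Ici 0) := by
  refine continuousOn_integral (F := fun x t => S.θx x t ^ 2 / (S.u x t * S.θ x t)) ?_
  exact (continuousOn_θx.pow 2).div (continuousOn_u.mul continuousOn_θ) fun p hp =>
    mul_ne_zero (u_ne_zero p hp) (θ_ne_zero p hp)

lemma heatDissipation_nonneg (ht : 0 ≤ t) : 0 ≤ S.heatDissipation t :=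
  integral_nonneg_Icc fun x hx => by
    have := S.hu_pos x hx t ht
    have := S.hθ_pos x hx t ht
    positivity

lemma hasDerivWithinAt_relEntropy (ht : 0 ≤ t) :
    HasDerivWithinAt S.relEntropy
      (S.geomMean t ^ (1 - S.β) * (S.V t + ∫ x in (0:ℝ)..1, S.stress x t)
        - (∫ x in (0:ℝ)..1, S.θ x t ^ (-S.β) * (S.stress x t * S.vx x t))
        - S.β * S.heatDissipation t) (Ici 0) t := by
  have h1 := hasDerivWithinAt_integral (F := fun x t => S.kirchhoff (S.θ x t))
    (G := fun x t => S.θ x t ^ (-S.β) * S.θt x t)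
    ((continuousOn_rpow_θ _).mul continuousOn_θt)
    (continuousOn_comp_θ S.continuousOn_kirchhoff)
    (fun x hx t ht => hasDerivWithinAt_comp_θ_time
      (fun s hs => S.hasDerivAt_kirchhoff hs) hx ht) (y := 1) (by simp) ht
  have h2 := (S.hasDerivAt_kirchhoff (geomMean_pos (S := S) (t := t))).comp_hasDerivWithinAt t
    (hasDerivWithinAt_geomMean (S := S) ht)
  refine (h2.sub h1).congr_deriv ?_
  have e := integral_mul_θt (S := S) (f := fun s => s ^ (-S.β))
    (f' := fun s => -S.β * s ^ (-S.β - 1))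
    (fun s hs => hasDerivAt_rpow_const (Or.inl (ne_of_gt hs)))
    (continuousOn_const.mul (continuousOn_rpow_const_Ioi _)) ht
  have e2 : ∫ x in (0:ℝ)..1, -S.β * S.θ x t ^ (-S.β - 1)
      * (S.θ x t ^ S.β * S.θx x t ^ 2 / S.u x t) = -S.β * S.heatDissipation t := by
    rw [heatDissipation, ← intervalIntegral.integral_const_mul]
    refine intervalIntegral.integral_congr fun x hx => ?_
    rw [uIcc_of_le zero_le_one] at hx
    have hθ := S.hθ_pos x hx t ht
    have hu := (S.hu_pos x hx t ht).ne'
    have hp := (rpow_pos_of_pos hθ S.β).ne'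
    have hθ' := hθ.ne'
    simp only [rpow_sub_one hθ', rpow_neg hθ.le]
    field_simp
  rw [e, e2, sub_eq_add_neg 1, rpow_add geomMean_pos, rpow_one]
  ring

lemma sq_integral_stress_le {m : ℝ} (hm : 0 < m) (ht : 0 ≤ t)
    (hu : ∀ x ∈ Icc (0:ℝ) 1, m ≤ S.u x t) :
    (∫ x in (0:ℝ)..1, S.stress x t) ^ 2 ≤ S.V t * (S.E₀ / m) := by
  have c1 := continuousOn_slice_fst S.continuousOn_u ht
  have c2 := continuousOn_slice_fst S.continuousOn_θ ht
  have hb : ContinuousOn (fun x => S.θ x t / m) (Icc 0 1) := c2.div_const m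
  refine (sq_integral_le_of_sq_le (continuousOn_slice_fst S.continuousOn_stress ht)
    (continuousOn_viscous_dissipation (S := S) ht) hb
    (viscous_dissipation_nonneg ht) (fun x hx => div_nonneg (S.hθ_pos x hx t ht).le hm.le)
    fun x hx => ?_).trans ?_
  · have hθ := S.hθ_pos x hx t ht
    rw [show S.u x t * S.stress x t ^ 2 / S.θ x t * (S.θ x t / m)
      = S.u x t / m * S.stress x t ^ 2 by field_simp]
    have := (one_le_div hm).2 (hu x hx)
    nlinarith [sq_nonneg (S.stress x t)]
  · refine mul_le_mul (viscous_dissipation_le_V ht) ?_ (integral_nonneg_Icc fun x hx =>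
      div_nonneg (S.hθ_pos x hx t ht).le hm.le) (V_nonneg_s8 ht)
    rw [intervalIntegral.integral_div]
    exact div_le_div_of_nonneg_right (integral_θ_le ht) hm.le

lemma neg_integral_power_le {m L : ℝ} (hm : 0 < m) (ht : 0 ≤ t)
    (hu : ∀ x ∈ Icc (0:ℝ) 1, m ≤ S.u x t) (hθ : ∀ x ∈ Icc (0:ℝ) 1, S.θ x t ≤ L) :
    -(∫ x in (0:ℝ)..1, S.θ x t ^ (-S.β) * (S.stress x t * S.vx x t)) ≤
      ((L + S.β) * S.E₀ + 1 - S.β * ∫ x in (0:ℝ)..1, S.kirchhoff (S.θ x t)) / (4 * m) := by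
  have c1 := continuousOn_slice_fst S.continuousOn_stress ht
  have c2 := continuousOn_slice_fst S.continuousOn_θ ht
  have c3 := continuousOn_slice_fst S.continuousOn_vx ht
  have c4 := continuousOn_slice_fst (F := fun x t => S.θ x t ^ (-S.β))
    (S.continuousOn_rpow_θ _) ht
  have c5 := continuousOn_slice_fst (F := fun x t => S.kirchhoff (S.θ x t))
    (continuousOn_comp_θ S.continuousOn_kirchhoff) ht
  have hL : 0 ≤ L := (S.hθ_pos 0 (by simp) t ht).le.trans (hθ 0 (by simp))
  have hβ := S.hβ
  have c6 : ContinuousOn (fun x => (L + S.β) * S.θ x t + 1 - S.β * S.kirchhoff (S.θ x t))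
      (Icc 0 1) := by fun_prop
  rw [← intervalIntegral.integral_neg]
  calc _ ≤ ∫ x in (0:ℝ)..1,
        ((L + S.β) * S.θ x t + 1 - S.β * S.kirchhoff (S.θ x t)) / (4 * m) := by
        refine integral_mono_Icc (by fun_prop) (c6.div_const _) fun x hx => ?_
        have h1 := S.hθ_pos x hx t ht
        have h2 := hu x hx
        have h3 := S.sq_mul_rpow_neg_le h1 (hθ x hx)
        have h4 := rpow_pos_of_pos h1 (-S.β)
        have hu0 := hm.trans_le h2
        refine le_trans ?_ (div_le_div_of_nonneg_right h3 (by positivity))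
        rw [vx_eq hx ht, le_div_iff₀ (by positivity)]
        have h5 : -(S.stress x t * (S.u x t * S.stress x t + S.θ x t)) * (4 * m)
            ≤ S.θ x t ^ 2 := by
          have h6 : -(S.stress x t * (S.u x t * S.stress x t + S.θ x t)) * (4 * m)
            ≤ -(S.stress x t * (m * S.stress x t + S.θ x t)) * (4 * m) := by
            refine mul_le_mul_of_nonneg_right ?_ (by positivity)
            nlinarith [sq_nonneg (S.stress x t)]
          nlinarith [sq_nonneg (2 * m * S.stress x t + S.θ x t)]
        nlinarith [mul_le_mul_of_nonneg_left h5 h4.le]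
    _ = ((L + S.β) * (∫ x in (0:ℝ)..1, S.θ x t) + 1
        - S.β * ∫ x in (0:ℝ)..1, S.kirchhoff (S.θ x t)) / (4 * m) := by
        have i2 := intervalIntegrable_of_Icc c2
        have i5 := intervalIntegrable_of_Icc c5
        rw [intervalIntegral.integral_div, intervalIntegral.integral_sub
          ((i2.const_mul _).add intervalIntegrable_const) (i5.const_mul _),
          intervalIntegral.integral_add (i2.const_mul _) intervalIntegrable_const]
        simp
    _ ≤ _ := by
        refine div_le_div_of_nonneg_right ?_ (by positivity)
        have := mul_le_mul_of_nonneg_left (integral_θ_le (S := S) ht) (add_nonneg hL hβ.le)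
        linarith

lemma neg_integral_power_sub_le {m A : ℝ} (hm : 0 < m) (hA : 0 ≤ A) (ht : 0 ≤ t)
    (hu : ∀ x ∈ Icc (0:ℝ) 1, m ≤ S.u x t)
    (h : ∀ x ∈ Icc (0:ℝ) 1,
      (S.θ x t ^ (1 - S.β) - S.geomMean t ^ (1 - S.β)) ^ 2 ≤ A * S.V t) :
    S.geomMean t ^ (1 - S.β) * (∫ x in (0:ℝ)..1, S.stress x t)
      - ∫ x in (0:ℝ)..1, S.θ x t ^ (-S.β) * (S.stress x t * S.vx x t) ≤
      (A * (S.E₀ / m) + 1) * S.V t := by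
  have c1 := continuousOn_slice_fst S.continuousOn_stress ht
  have c2 := continuousOn_slice_fst S.continuousOn_θ ht
  have c3 := continuousOn_slice_fst S.continuousOn_vx ht
  have c4 := continuousOn_slice_fst (F := fun x t => S.θ x t ^ (-S.β))
    (S.continuousOn_rpow_θ _) ht
  have c7 := continuousOn_viscous_dissipation (S := S) ht
  have hV := V_nonneg_s8 (S := S) ht
  set G := S.geomMean t ^ (1 - S.β)
  have i1 : IntervalIntegrable (fun x => G * S.stress x t) volume 0 1 :=
    intervalIntegrable_of_Icc (by fun_prop)
  have i2 : IntervalIntegrable (fun x => S.θ x t ^ (-S.β) * (S.stress x t * S.vx x t))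
    volume 0 1 := intervalIntegrable_of_Icc (by fun_prop)
  rw [← intervalIntegral.integral_const_mul, ← intervalIntegral.integral_sub i1 i2]
  calc _ ≤ ∫ x in (0:ℝ)..1,
        (A * S.V t / m * S.θ x t + S.u x t * S.stress x t ^ 2 / S.θ x t) := by
        refine integral_mono_Icc (by fun_prop) (by fun_prop) fun x hx => ?_
        have h1 := S.hθ_pos x hx t ht
        have h2 := hu x hx
        have h4 := rpow_pos_of_pos h1 (-S.β)
        have hu0 := hm.trans_le h2
        have h5 := h x hx
        have e : S.θ x t ^ (1 - S.β) = S.θ x t * S.θ x t ^ (-S.β) := by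
          rw [sub_eq_add_neg, rpow_add h1, rpow_one]
        rw [vx_eq hx ht]
        set a := S.θ x t ^ (1 - S.β) - G with ha
        have e2 : G * S.stress x t - S.θ x t ^ (-S.β)
            * (S.stress x t * (S.u x t * S.stress x t + S.θ x t))
            = -a * S.stress x t - S.θ x t ^ (-S.β) * S.u x t * S.stress x t ^ 2 := by
          rw [ha, e]; ring
        have h6 : 0 ≤ S.θ x t ^ (-S.β) * S.u x t * S.stress x t ^ 2 := by positivity
        have h7 : -a * S.stress x t ≤ a ^ 2 * (S.θ x t / S.u x t)
            + S.u x t * S.stress x t ^ 2 / S.θ x t := by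
          set q := S.u x t / S.θ x t with hq
          have hq0 : 0 < q := by positivity
          rw [show S.θ x t / S.u x t = q⁻¹ by rw [hq, inv_div],
            show S.u x t * S.stress x t ^ 2 / S.θ x t = q * S.stress x t ^ 2 by rw [hq]; ring]
          have : a ^ 2 * q⁻¹ + q * S.stress x t ^ 2 + a * S.stress x t
              = q * ((S.stress x t + a * q⁻¹ / 2) ^ 2 + 3 / 4 * (a * q⁻¹) ^ 2) := by
            field_simp; ring
          have h8 : 0 ≤ q * ((S.stress x t + a * q⁻¹ / 2) ^ 2 + 3 / 4 * (a * q⁻¹) ^ 2) := by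
            positivity
          linarith
        have h8 : a ^ 2 * (S.θ x t / S.u x t) ≤ A * S.V t / m * S.θ x t := by
          calc _ ≤ A * S.V t * (S.θ x t / m) := by gcongr
            _ = _ := by ring
        linarith
    _ = A * S.V t / m * (∫ x in (0:ℝ)..1, S.θ x t)
        + ∫ x in (0:ℝ)..1, S.u x t * S.stress x t ^ 2 / S.θ x t := by
        rw [intervalIntegral.integral_add ((intervalIntegrable_of_Icc c2).const_mul _)
          (intervalIntegrable_of_Icc c7), intervalIntegral.integral_const_mul]
    _ ≤ A * S.V t / m * S.E₀ + S.V t := by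
        gcongr
        · exact integral_θ_le ht
        · exact viscous_dissipation_le_V ht
    _ = _ := by ring

variable (S) in
/-- The heat dissipation is integrable in time. -/
lemma exists_integral_heatDissipation_le :
    ∃ C, 0 ≤ C ∧ ∀ t ∈ Ici (0:ℝ), ∫ s in (0:ℝ)..t, S.heatDissipation s ≤ C := by
  obtain ⟨I, hI0, hI⟩ := S.exists_integral_V_le
  obtain ⟨m, hm, hu⟩ := S.exists_le_u
  obtain ⟨C₀, hC₀, hθ⟩ := S.exists_θ_le
  obtain ⟨δ, c, C₁, hδ, hc, hδθ⟩ := S.exists_θ_bounds_of_V_le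
  obtain ⟨g₀, g₁, hg₀, hg⟩ := S.exists_geomMean_bounds
  obtain ⟨A, hA, hAθ⟩ := exists_sq_sub_geomMean_le hc hδθ
    (fun s hs => hasDerivAt_rpow_const (p := 1 - S.β) (Or.inl (ne_of_gt hs)))
    (continuousOn_const.mul (continuousOn_rpow_const_Ioi _))
  have hβ := S.hβ
  have hE := E₀_nonneg (S := S)
  have hsub : Icc g₀ g₁ ⊆ Ioi 0 := fun s hs => hg₀.trans_le hs.1
  obtain ⟨B, hB⟩ := isCompact_Icc.exists_bound_of_continuousOn (S.continuousOn_kirchhoff.mono hsub)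
  obtain ⟨G, hG⟩ := isCompact_Icc.exists_bound_of_continuousOn
    ((continuousOn_rpow_const_Ioi (1 - S.β)).mono hsub)
  have hB' : ∀ t ∈ Ici (0:ℝ), |S.kirchhoff (S.geomMean t)| ≤ B := fun t ht => hB _ (hg t ht)
  have hG' : ∀ t ∈ Ici (0:ℝ), S.geomMean t ^ (1 - S.β) ≤ G := fun t ht =>
    (le_abs_self _).trans (hG _ (hg t ht))
  have hG0 : 0 ≤ G := (rpow_pos_of_pos geomMean_pos _).le.trans (hG' 0 self_mem_Ici)
  have hent : ∀ t ∈ Ici (0:ℝ), ∫ x in (0:ℝ)..1, S.kirchhoff (S.θ x t) ≤ S.E₀ := fun t ht =>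
    (integral_mono_Icc (continuousOn_slice_fst (F := fun x t => S.kirchhoff (S.θ x t))
      (continuousOn_comp_θ S.continuousOn_kirchhoff) ht)
      (continuousOn_slice_fst S.continuousOn_θ ht) fun x hx => by
        linarith [S.kirchhoff_le (S.hθ_pos x hx t ht)]).trans (integral_θ_le ht)
  set Φ : ℝ → ℝ := fun t => S.E₀ + B + S.relEntropy t with hΦ
  have hΦ0 : ∀ t ∈ Ici (0:ℝ), 0 ≤ Φ t := fun t ht => by
    have := abs_le.1 (hB' t ht)
    have := hent t ht
    simp only [hΦ, relEntropy]
    linarith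
  set K := G + (A * (S.E₀ / m) + 1) + G * (1 + S.E₀ / m / δ)
    + ((C₀ * (1 / δ + 1) + S.β / δ) * S.E₀ + 1 / δ + S.β / δ) / (4 * m) with hK
  have hK0 : 0 ≤ K := by positivity
  have hgron := fun T hT => gronwall_dissipation (φ := Φ)
    (d := fun t => S.β * S.heatDissipation t) (k := fun t => K * S.V t) (I := K * I)
    (fun t ht => (hasDerivWithinAt_relEntropy ht).const_add (S.E₀ + B))
    (continuousOn_const.mul continuousOn_heatDissipation)
    (continuousOn_const.mul continuousOn_V) hΦ0
    (fun t ht => mul_nonneg hβ.le (heatDissipation_nonneg ht))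
    (fun t ht => mul_nonneg hK0 (V_nonneg_s8 ht))
    (fun t ht => by
      rw [intervalIntegral.integral_const_mul]
      exact mul_le_mul_of_nonneg_left (hI t ht) hK0)
    (fun t ht => ?_) (T := T) hT
  · refine ⟨(1 + Φ 0) * exp (K * I) / S.β, ?_, fun t ht => ?_⟩
    · have := hΦ0 0 self_mem_Ici
      positivity
    · have h1 := hgron t ht
      have h2 := hΦ0 t ht
      rw [intervalIntegral.integral_const_mul] at h1
      rw [le_div_iff₀ hβ]
      linarith
  · have hV := V_nonneg_s8 (S := S) ht
    have hg' := rpow_pos_of_pos (geomMean_pos (S := S) (t := t)) (1 - S.β)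
    have hGt := hG' t ht
    have hΦt := hΦ0 t ht
    have hGV := mul_le_mul_of_nonneg_right hGt hV
    suffices h : S.geomMean t ^ (1 - S.β) * (∫ x in (0:ℝ)..1, S.stress x t)
        - (∫ x in (0:ℝ)..1, S.θ x t ^ (-S.β) * (S.stress x t * S.vx x t))
        ≤ (K - G) * S.V t * (1 + Φ t) by
      have : 0 ≤ G * S.V t * Φ t := by positivity
      rw [mul_add (S.geomMean t ^ (1 - S.β))]
      nlinarith
    rcases le_total (S.V t) δ with h | h
    · refine (neg_integral_power_sub_le hm hA ht (fun x hx => hu x hx t ht)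
        (fun x hx => hAθ t ht h x hx)).trans ?_
      have h1 : A * (S.E₀ / m) + 1 ≤ K - G := by
        have : 0 ≤ G * (1 + S.E₀ / m / δ) := by positivity
        have : 0 ≤ ((C₀ * (1 / δ + 1) + S.β / δ) * S.E₀ + 1 / δ + S.β / δ) / (4 * m) := by
          positivity
        linarith
      have h2 : 0 ≤ A * (S.E₀ / m) + 1 := by positivity
      calc _ ≤ (K - G) * S.V t := mul_le_mul_of_nonneg_right h1 hV
        _ ≤ _ := le_mul_of_one_le_right (mul_nonneg (h2.trans h1) hV) (by linarith)
    · have hδV : 1 ≤ S.V t / δ := (one_le_div hδ).2 h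
      have h1 : S.geomMean t ^ (1 - S.β) * (∫ x in (0:ℝ)..1, S.stress x t)
          ≤ G * (1 + S.E₀ / m / δ) * S.V t := by
        have h2 := sq_integral_stress_le hm ht fun x hx => hu x hx t ht
        have h3 : 0 ≤ S.E₀ / m := by positivity
        have h4 : |∫ x in (0:ℝ)..1, S.stress x t| ≤ S.V t + S.E₀ / m := by
          refine abs_le_of_sq_le_sq ?_ (by positivity)
          nlinarith
        calc _ ≤ S.geomMean t ^ (1 - S.β) * (S.V t + S.E₀ / m) :=
              mul_le_mul_of_nonneg_left ((le_abs_self _).trans h4) hg'.le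
          _ ≤ G * (S.V t + S.E₀ / m * (S.V t / δ)) := by
              gcongr
              exact le_mul_of_one_le_right h3 hδV
          _ = _ := by ring
      have h2 := neg_integral_power_le hm ht (fun x hx => hu x hx t ht)
        (fun x hx => hθ x hx t ht)
      have h3 : -(∫ x in (0:ℝ)..1, S.kirchhoff (S.θ x t)) ≤ Φ t := by
        have := abs_le.1 (hB' t ht)
        simp only [hΦ, relEntropy]
        linarith
      have h4 : (C₀ * (1 + S.V t) + S.β) * S.E₀ + 1
            - S.β * ∫ x in (0:ℝ)..1, S.kirchhoff (S.θ x t)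
          ≤ ((C₀ * (1 / δ + 1) + S.β / δ) * S.E₀ + 1 / δ + S.β / δ) * S.V t * (1 + Φ t) := by
        calc _ ≤ (C₀ * (1 + S.V t) + S.β) * S.E₀ + 1 + S.β * Φ t := by nlinarith
          _ ≤ (C₀ * (S.V t / δ + S.V t) + S.β * (S.V t / δ)) * S.E₀ + S.V t / δ
              + S.β * (S.V t / δ) * Φ t := by
              gcongr
              · exact le_mul_of_one_le_right hβ.le hδV
              · exact le_mul_of_one_le_right hβ.le hδV
          _ ≤ ((C₀ * (S.V t / δ + S.V t) + S.β * (S.V t / δ)) * S.E₀ + S.V t / δ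
              + S.β * (S.V t / δ)) * (1 + Φ t) := by
              rw [add_mul _ _ (1 + Φ t)]
              refine add_le_add (le_mul_of_one_le_right (by positivity) (by linarith))
                (mul_le_mul_of_nonneg_left (by linarith) (by positivity))
          _ = _ := by ring
      have h5 := div_le_div_of_nonneg_right h4 (by positivity : 0 ≤ 4 * m)
      have h6 : G * (1 + S.E₀ / m / δ) * S.V t ≤ G * (1 + S.E₀ / m / δ) * S.V t * (1 + Φ t) :=
        le_mul_of_one_le_right (by positivity) (by linarith)
      have h7 : 0 ≤ (A * (S.E₀ / m) + 1) * S.V t * (1 + Φ t) := by positivity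
      calc _ ≤ G * (1 + S.E₀ / m / δ) * S.V t * (1 + Φ t)
            + ((C₀ * (1 / δ + 1) + S.β / δ) * S.E₀ + 1 / δ + S.β / δ) * S.V t * (1 + Φ t)
              / (4 * m) := by linarith
        _ ≤ _ := by
          rw [hK]
          linear_combination h7

end HeatFlux

section Gradient

variable (S)

/-- The deviation of the velocity from the affine profile with slope the geometric mean of the
temperature. -/
noncomputable def velocityDefect (x t : ℝ) : ℝ :=
  S.v x t - ((∫ y in (0:ℝ)..1, S.v y 0) + S.geomMean t * (x - 1 / 2))

/-- The effective gradient `u_x/u - q`, with `q` the velocity defect. -/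
noncomputable def effectiveGradient (x t : ℝ) : ℝ := S.ux x t / S.u x t - S.velocityDefect x t

/-- The time derivative of the geometric mean of the temperature. -/
noncomputable def geomMeanRate (t : ℝ) : ℝ :=
  S.geomMean t * (S.V t + ∫ x in (0:ℝ)..1, S.stress x t)

variable {S} {x : ℝ}

lemma continuousOn_geomMean : ContinuousOn S.geomMean (Ici 0) := fun _ ht =>
  (hasDerivWithinAt_geomMean ht).continuousWithinAt

lemma continuousOn_geomMeanRate : ContinuousOn S.geomMeanRate (Ici 0) :=
  continuousOn_geomMean.mul (continuousOn_V.add (continuousOn_integral continuousOn_stress))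

lemma continuousOn_comp_snd {f : ℝ → ℝ} (hf : ContinuousOn f (Ici 0)) :
    ContinuousOn (fun p : ℝ × ℝ => f p.2) strip :=
  hf.comp continuous_snd.continuousOn fun _ hp => hp.2

lemma continuousOn_velocityDefect :
    ContinuousOn (fun p : ℝ × ℝ => S.velocityDefect p.1 p.2) strip := by
  have h := continuousOn_comp_snd (S.continuousOn_geomMean)
  have hv := S.continuousOn_v
  unfold velocityDefect
  fun_prop

lemma continuousOn_effectiveGradient :
    ContinuousOn (fun p : ℝ × ℝ => S.effectiveGradient p.1 p.2) strip :=
  (continuousOn_ux.div continuousOn_u u_ne_zero).sub continuousOn_velocityDefect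

lemma integral_velocityDefect (ht : 0 ≤ t) : ∫ x in (0:ℝ)..1, S.velocityDefect x t = 0 := by
  have h1 := intervalIntegrable_of_Icc (continuousOn_slice_fst S.continuousOn_v ht)
  have h2 : IntervalIntegrable
    (fun x => (∫ y in (0:ℝ)..1, S.v y 0) + S.geomMean t * (x - 1 / 2)) volume 0 1 :=
    Continuous.intervalIntegrable (by fun_prop) _ _
  unfold velocityDefect
  rw [intervalIntegral.integral_sub h1 h2, integral_v_eq ht, intervalIntegral.integral_add
    intervalIntegrable_const (Continuous.intervalIntegrable (by fun_prop) _ _),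
    intervalIntegral.integral_const_mul, intervalIntegral.integral_sub
    intervalIntegral.intervalIntegrable_id intervalIntegrable_const]
  simp

lemma hasDerivWithinAt_velocityDefect (hx : x ∈ Icc (0:ℝ) 1) (ht : 0 ≤ t) :
    HasDerivWithinAt (fun y => S.velocityDefect y t) (S.vx x t - S.geomMean t) (Icc 0 1) x := by
  refine ((S.hvx x hx t ht).sub ((((hasDerivWithinAt_id x (Icc (0:ℝ) 1)).sub_const
    (1 / 2)).const_mul (S.geomMean t)).const_add (∫ y in (0:ℝ)..1, S.v y 0))).congr_deriv ?_
  ring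

lemma hasDerivWithinAt_velocityDefect_time (hx : x ∈ Icc (0:ℝ) 1) (ht : 0 ≤ t) :
    HasDerivWithinAt (fun s => S.velocityDefect x s)
      (S.vt x t - S.geomMeanRate t * (x - 1 / 2)) (Ici 0) t :=
  (S.hvt x hx t ht).sub (((hasDerivWithinAt_geomMean ht).mul_const (x - 1 / 2)).const_add
    (∫ y in (0:ℝ)..1, S.v y 0))

lemma vt_eq (hx : x ∈ Icc (0:ℝ) 1) (ht : 0 ≤ t) :
    S.vt x t = ((S.vxx x t - S.θx x t) * S.u x t - (S.vx x t - S.θ x t) * S.ux x t)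
      / S.u x t ^ 2 :=
  (uniqueDiffOn_Icc zero_lt_one x hx).eq_deriv _ (S.momentum x hx t ht)
    (((S.hvxx x hx t ht).sub (S.hθx x hx t ht)).div (S.hux x hx t ht) (S.hu_pos x hx t ht).ne')

lemma hasDerivWithinAt_ux_time (hx : x ∈ Icc (0:ℝ) 1) (ht : 0 ≤ t) :
    HasDerivWithinAt (fun s => S.ux x s) (S.vxx x t - S.ux x t) (Ici 0) t := by
  refine hasDerivWithinAt_mixed (F := S.u) (G := S.ut) (Gx := fun x t => S.vxx x t - S.ux x t)
    continuousOn_ut (continuousOn_vxx.sub continuousOn_ux) S.hux S.hut (fun x hx t ht => ?_) hx ht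
  refine ((S.hvxx x hx t ht).sub (S.hux x hx t ht)).congr (fun y hy => ?_) ?_
  · simpa using eq_sub_of_add_eq (S.mass y hy t ht)
  · simpa using eq_sub_of_add_eq (S.mass x hx t ht)

lemma hasDerivWithinAt_effectiveGradient (hx : x ∈ Icc (0:ℝ) 1) (ht : 0 ≤ t) :
    HasDerivWithinAt (fun s => S.effectiveGradient x s)
      (S.θx x t / S.u x t
        - S.θ x t / S.u x t * (S.effectiveGradient x t + S.velocityDefect x t)
        + S.geomMeanRate t * (x - 1 / 2)) (Ici 0) t := by
  have hu := (S.hu_pos x hx t ht).ne'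
  refine (((hasDerivWithinAt_ux_time hx ht).div (S.hut x hx t ht) hu).sub
    (hasDerivWithinAt_velocityDefect_time hx ht)).congr_deriv ?_
  rw [vt_eq hx ht, eq_sub_of_add_eq (S.mass x hx t ht), effectiveGradient]
  field_simp
  ring

lemma hasDerivWithinAt_integral_sq_effectiveGradient (ht : 0 ≤ t) :
    HasDerivWithinAt (fun s => ∫ x in (0:ℝ)..1, S.effectiveGradient x s ^ 2)
      (∫ x in (0:ℝ)..1, 2 * (S.effectiveGradient x t * (S.θx x t / S.u x t
        - S.θ x t / S.u x t * (S.effectiveGradient x t + S.velocityDefect x t)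
        + S.geomMeanRate t * (x - 1 / 2)))) (Ici 0) t := by
  have c1 := S.continuousOn_effectiveGradient
  have c2 := S.continuousOn_velocityDefect
  have c3 := S.continuousOn_θx
  have c4 := S.continuousOn_θ
  have c5 := S.continuousOn_u
  have c6 := continuousOn_comp_snd S.continuousOn_geomMeanRate
  have c7 := S.u_ne_zero
  refine hasDerivWithinAt_integral (F := fun x t => S.effectiveGradient x t ^ 2)
    (G := fun x t => 2 * (S.effectiveGradient x t * (S.θx x t / S.u x t
        - S.θ x t / S.u x t * (S.effectiveGradient x t + S.velocityDefect x t)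
        + S.geomMeanRate t * (x - 1 / 2))))
    (by fun_prop (disch := assumption)) (c1.pow 2) (fun x hx t ht => ?_) (y := 1) (by simp) ht
  refine ((hasDerivWithinAt_effectiveGradient hx ht).pow 2).congr_deriv ?_
  push_cast
  ring

variable (S) in
lemma exists_integral_sq_velocityDefect_le : ∃ C, 0 ≤ C ∧ ∀ t ∈ Ici (0:ℝ),
    ∫ x in (0:ℝ)..1, S.velocityDefect x t ^ 2 ≤ C := by
  obtain ⟨g₀, g₁, hg₀, hg⟩ := S.exists_geomMean_bounds
  have hE := E₀_nonneg (S := S)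
  set a := ∫ y in (0:ℝ)..1, S.v y 0 with ha
  refine ⟨2 * (2 * S.E₀) + 2 * (|a| + g₁) ^ 2, by positivity, fun t ht => ?_⟩
  have c1 := continuousOn_slice_fst S.continuousOn_v ht
  have c3 : ContinuousOn (fun x => S.v x t ^ 2) (Icc 0 1) := c1.pow 2
  have c2 := continuousOn_slice_fst S.continuousOn_velocityDefect ht
  calc _ ≤ ∫ x in (0:ℝ)..1, (2 * S.v x t ^ 2 + 2 * (|a| + g₁) ^ 2) := by
        refine integral_mono_Icc (by fun_prop) (by fun_prop) fun x hx => ?_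
        have h1 := (hg t ht).2
        have h2 := geomMean_pos (S := S) (t := t)
        have h3 : |a + S.geomMean t * (x - 1 / 2)| ≤ |a| + g₁ := by
          refine (abs_add_le _ _).trans (add_le_add le_rfl ?_)
          rw [abs_mul, abs_of_pos h2]
          have : |x - 1 / 2| ≤ 1 := abs_le.2 ⟨by linarith [hx.1], by linarith [hx.2]⟩
          nlinarith
        have h4 := sq_le_sq' (abs_le.1 h3).1 (abs_le.1 h3).2
        have e : S.velocityDefect x t = S.v x t - (a + S.geomMean t * (x - 1 / 2)) := rfl
        rw [e]
        nlinarith [sq_nonneg (S.v x t + (a + S.geomMean t * (x - 1 / 2)))]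
    _ = 2 * (∫ x in (0:ℝ)..1, S.v x t ^ 2) + 2 * (|a| + g₁) ^ 2 := by
        rw [intervalIntegral.integral_add
          ((intervalIntegrable_of_Icc c3).const_mul 2) intervalIntegrable_const,
          intervalIntegral.integral_const_mul]
        simp
    _ ≤ _ := by linarith [integral_v_sq_le (S := S) ht]

lemma exists_sq_velocityDefect_le {δ c C : ℝ} (hc : 0 < c)
    (hδ : ∀ t ∈ Ici (0:ℝ), S.V t ≤ δ → ∀ x ∈ Icc (0:ℝ) 1, c ≤ S.θ x t ∧ S.θ x t ≤ C) :
    ∃ B, 0 ≤ B ∧ ∀ t ∈ Ici (0:ℝ), S.V t ≤ δ →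
      ∫ x in (0:ℝ)..1, S.velocityDefect x t ^ 2 ≤ B * S.V t := by
  obtain ⟨M, hM, hu⟩ := S.exists_u_le
  obtain ⟨A, hA, hAθ⟩ := exists_sq_sub_geomMean_le hc hδ (fun s _ => hasDerivAt_id s)
    continuousOn_const
  refine ⟨2 * (M * max C 0) + 2 * A, by positivity, fun t ht hV => ?_⟩
  have c1 := continuousOn_slice_fst S.continuousOn_vx ht
  have c2 := continuousOn_slice_fst S.continuousOn_velocityDefect ht
  have c3 := continuousOn_viscous_dissipation (S := S) ht
  have c4 : ContinuousOn (fun x => S.vx x t - S.geomMean t) (Icc 0 1) := by fun_prop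
  have c5 : ContinuousOn (fun x => 2 * (M * max C 0) * (S.u x t * S.stress x t ^ 2 / S.θ x t)
    + 2 * (A * S.V t)) (Icc 0 1) := by fun_prop
  obtain ⟨y, hy, h0⟩ := exists_eq_integral c2
  rw [integral_velocityDefect ht] at h0
  have hVt := V_nonneg_s8 (S := S) ht
  have hcs := sq_integral_le_of_sq_le c4.abs c5 continuousOn_const
    (fun x hx => add_nonneg (mul_nonneg (by positivity) (viscous_dissipation_nonneg ht x hx))
      (by positivity)) (fun _ _ => zero_le_one) fun x hx => by
      have h1 := hAθ t ht hV x hx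
      have h2 := S.hθ_pos x hx t ht
      have h3 := S.hu_pos x hx t ht
      simp only [id] at h1
      rw [sq_abs, mul_one, vx_eq hx ht]
      have h4 : (S.u x t * S.stress x t) ^ 2
          ≤ M * max C 0 * (S.u x t * S.stress x t ^ 2 / S.θ x t) := by
        rw [show (S.u x t * S.stress x t) ^ 2
          = S.u x t * S.θ x t * (S.u x t * S.stress x t ^ 2 / S.θ x t) by field_simp]
        have := hu x hx t ht
        have := ((hδ t ht hV x hx).2).trans (le_max_left C 0)
        gcongr
      nlinarith [sq_nonneg (S.u x t * S.stress x t - (S.θ x t - S.geomMean t))]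
  have hle : ∀ x ∈ Icc (0:ℝ) 1,
      S.velocityDefect x t ^ 2 ≤ (2 * (M * max C 0) + 2 * A) * S.V t := fun x hx => by
    have h1 := abs_sub_le_integral_abs (fun x hx => hasDerivWithinAt_velocityDefect (S := S) hx ht)
      c4 hy hx
    rw [h0, sub_zero] at h1
    calc _ = |S.velocityDefect x t| ^ 2 := (sq_abs _).symm
      _ ≤ (∫ x in (0:ℝ)..1, |S.vx x t - S.geomMean t|) ^ 2 :=
        pow_le_pow_left₀ (abs_nonneg _) h1 2
      _ ≤ _ := hcs
      _ = 2 * (M * max C 0) * (∫ x in (0:ℝ)..1, S.u x t * S.stress x t ^ 2 / S.θ x t)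
          + 2 * (A * S.V t) := by
        rw [intervalIntegral.integral_add ((intervalIntegrable_of_Icc c3).const_mul _)
          intervalIntegrable_const, intervalIntegral.integral_const_mul]
        simp
      _ ≤ 2 * (M * max C 0) * S.V t + 2 * (A * S.V t) := by
        gcongr
        exact viscous_dissipation_le_V ht
      _ = _ := by ring
  simpa using integral_mono_Icc (c2.pow 2) (continuousOn_const) hle

lemma abs_geomMeanRate_le {m G : ℝ} (hm : 0 < m) (ht : 0 ≤ t)
    (hu : ∀ x ∈ Icc (0:ℝ) 1, m ≤ S.u x t) (hG : S.geomMean t ≤ G) :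
    |S.geomMeanRate t| ≤ G * (2 * S.V t + S.E₀ / m) := by
  have h1 := sq_integral_stress_le hm ht hu
  have hV := V_nonneg_s8 (S := S) ht
  have h2 : 0 ≤ S.E₀ / m := div_nonneg E₀_nonneg hm.le
  have h3 : |∫ x in (0:ℝ)..1, S.stress x t| ≤ S.V t + S.E₀ / m :=
    abs_le_of_sq_le_sq (by nlinarith) (by positivity)
  rw [geomMeanRate, abs_mul, abs_of_pos geomMean_pos]
  refine mul_le_mul hG ((abs_add_le _ _).trans ?_) (abs_nonneg _) (geomMean_pos.le.trans hG)
  rw [abs_of_nonneg hV]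
  linarith

lemma sq_geomMeanRate_le {m G : ℝ} (hm : 0 < m) (ht : 0 ≤ t)
    (hu : ∀ x ∈ Icc (0:ℝ) 1, m ≤ S.u x t) (hG : S.geomMean t ≤ G) :
    S.geomMeanRate t ^ 2 ≤ 2 * G ^ 2 * (S.V t + S.E₀ / m) * S.V t := by
  have h1 := sq_integral_stress_le hm ht hu
  have h2 := pow_le_pow_left₀ geomMean_pos.le hG 2
  rw [geomMeanRate, mul_pow]
  calc _ ≤ G ^ 2 * (2 * (S.V t + S.E₀ / m) * S.V t) := by
        refine mul_le_mul h2 ?_ (sq_nonneg _) (sq_nonneg _)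
        nlinarith [sq_nonneg (S.V t - ∫ x in (0:ℝ)..1, S.stress x t)]
    _ = _ := by ring

lemma integral_effectiveGradient_mul_le {a κ : ℝ} (ht : 0 ≤ t)
    (ha : ∀ x ∈ Icc (0:ℝ) 1, S.θ x t / S.u x t ≤ a)
    (hκ : ∀ x ∈ Icc (0:ℝ) 1, S.geomMeanRate t * (x - 1 / 2) * S.effectiveGradient x t
      - S.θ x t / S.u x t * S.effectiveGradient x t ^ 2 / 2
      ≤ κ * (1 + S.effectiveGradient x t ^ 2)) :
    ∫ x in (0:ℝ)..1, 2 * (S.effectiveGradient x t * (S.θx x t / S.u x t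
        - S.θ x t / S.u x t * (S.effectiveGradient x t + S.velocityDefect x t)
        + S.geomMeanRate t * (x - 1 / 2)))
      ≤ 2 * (S.heatDissipation t + a * (∫ x in (0:ℝ)..1, S.velocityDefect x t ^ 2)
        + κ * (1 + ∫ x in (0:ℝ)..1, S.effectiveGradient x t ^ 2)) := by
  have c1 := continuousOn_slice_fst S.continuousOn_effectiveGradient ht
  have c2 := continuousOn_slice_fst S.continuousOn_velocityDefect ht
  have c3 := continuousOn_slice_fst S.continuousOn_θx ht
  have c4 := continuousOn_slice_fst S.continuousOn_θ ht
  have c5 := continuousOn_slice_fst S.continuousOn_u ht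
  have hu : ∀ x ∈ Icc (0:ℝ) 1, S.u x t ≠ 0 := fun x hx => (S.hu_pos x hx t ht).ne'
  have hθ : ∀ x ∈ Icc (0:ℝ) 1, S.u x t * S.θ x t ≠ 0 := fun x hx =>
    mul_ne_zero (hu x hx) (S.hθ_pos x hx t ht).ne'
  have c6 : ContinuousOn (fun x => S.θx x t ^ 2 / (S.u x t * S.θ x t)) (Icc 0 1) := by
    fun_prop (disch := assumption)
  have c7 : ContinuousOn (fun x => a * S.velocityDefect x t ^ 2) (Icc 0 1) := by fun_prop
  have c8 : ContinuousOn (fun x => κ * (1 + S.effectiveGradient x t ^ 2)) (Icc 0 1) := by fun_prop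
  rw [intervalIntegral.integral_const_mul]
  refine mul_le_mul_of_nonneg_left ?_ zero_le_two
  calc _ ≤ ∫ x in (0:ℝ)..1, (S.θx x t ^ 2 / (S.u x t * S.θ x t) + a * S.velocityDefect x t ^ 2
        + κ * (1 + S.effectiveGradient x t ^ 2)) := by
        refine integral_mono_Icc (by fun_prop (disch := assumption)) ((c6.add c7).add c8)
          fun x hx => ?_
        have h1 := S.hu_pos x hx t ht
        have h2 := S.hθ_pos x hx t ht
        have h3 := hκ x hx
        have h4 := mul_le_mul_of_nonneg_right (ha x hx) (sq_nonneg (S.velocityDefect x t))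
        set p := S.effectiveGradient x t
        set q := S.velocityDefect x t
        set b := S.θ x t / S.u x t with hb
        have hb0 : 0 < b := by positivity
        have h5 : p * (S.θx x t / S.u x t) ≤ b * p ^ 2 / 4
            + S.θx x t ^ 2 / (S.u x t * S.θ x t) := by
          have : b * p ^ 2 / 4 + S.θx x t ^ 2 / (S.u x t * S.θ x t) - p * (S.θx x t / S.u x t)
              = b * (p / 2 - S.θx x t / S.θ x t) ^ 2 := by
            rw [hb]; field_simp; ring
          have : 0 ≤ b * (p / 2 - S.θx x t / S.θ x t) ^ 2 := by positivity
          linarith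
        have h6 : -(b * p * q) ≤ b * p ^ 2 / 4 + b * q ^ 2 := by
          nlinarith [mul_nonneg hb0.le (sq_nonneg (p / 2 + q))]
        linarith
    _ = _ := by
        have c9 : ContinuousOn (fun x => S.θx x t ^ 2 / (S.u x t * S.θ x t)
            + a * S.velocityDefect x t ^ 2) (Icc 0 1) := c6.add c7
        have i1 : IntervalIntegrable (fun x => S.effectiveGradient x t ^ 2) volume 0 1 :=
          intervalIntegrable_of_Icc (c1.pow 2)
        rw [intervalIntegral.integral_add (intervalIntegrable_of_Icc c9)
          (intervalIntegrable_of_Icc c8), intervalIntegral.integral_add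
          (intervalIntegrable_of_Icc c6) (intervalIntegrable_of_Icc c7),
          intervalIntegral.integral_const_mul, intervalIntegral.integral_const_mul,
          intervalIntegral.integral_add intervalIntegrable_const i1, heatDissipation]
        simp

variable (S) in
lemma exists_integral_sq_effectiveGradient_le : ∃ C, 0 ≤ C ∧ ∀ t ∈ Ici (0:ℝ),
    ∫ x in (0:ℝ)..1, S.effectiveGradient x t ^ 2 ≤ C := by
  obtain ⟨I, hI0, hI⟩ := S.exists_integral_V_le
  obtain ⟨J, hJ0, hJ⟩ := S.exists_integral_heatDissipation_le
  obtain ⟨m, hm, hu⟩ := S.exists_le_u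
  obtain ⟨M, hM, hu'⟩ := S.exists_u_le
  obtain ⟨C₀, hC₀, hθ⟩ := S.exists_θ_le
  obtain ⟨δ, c, C₁, hδ, hc, hδθ⟩ := S.exists_θ_bounds_of_V_le
  obtain ⟨g₀, G, hg₀, hg⟩ := S.exists_geomMean_bounds
  obtain ⟨B, hB, hQ⟩ := exists_sq_velocityDefect_le hc hδθ
  obtain ⟨Q, hQ0, hQ'⟩ := S.exists_integral_sq_velocityDefect_le
  have hE := E₀_nonneg (S := S)
  have hG : 0 < G := geomMean_pos.trans_le (hg 0 self_mem_Ici).2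
  set K₁ := C₀ / m * ((1 + δ) * B + (1 / δ + 1) * Q) with hK₁
  set K₂ := 2 * G ^ 2 * (δ + S.E₀ / m) * (M / c) + G * (2 + S.E₀ / m / δ) with hK₂
  have hK₁0 : 0 ≤ K₁ := by positivity
  have hK₂0 : 0 ≤ K₂ := by positivity
  set N : ℝ → ℝ := fun t => ∫ x in (0:ℝ)..1, S.effectiveGradient x t ^ 2 with hN
  have hN0 : ∀ t, 0 ≤ N t := fun t => integral_nonneg_Icc fun x _ => sq_nonneg _
  have hk : ContinuousOn (fun t => 2 * (S.heatDissipation t + (K₁ + K₂) * S.V t)) (Ici 0) :=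
    continuousOn_const.mul (continuousOn_heatDissipation.add
      (continuousOn_const.mul continuousOn_V))
  have hgron := fun T hT => gronwall_dissipation (φ := N) (d := fun _ => 0)
    (k := fun t => 2 * (S.heatDissipation t + (K₁ + K₂) * S.V t)) (I := 2 * (J + (K₁ + K₂) * I))
    (fun t ht => hasDerivWithinAt_integral_sq_effectiveGradient ht) continuousOn_const hk
    (fun t _ => hN0 t) (fun _ _ => le_rfl)
    (fun t ht => by
      have := heatDissipation_nonneg (S := S) ht
      have := V_nonneg_s8 (S := S) ht
      positivity)
    (fun t ht => by
      have hsub : uIcc 0 t ⊆ Ici (0:ℝ) := by rw [uIcc_of_le ht]; exact Icc_subset_Ici_self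
      rw [intervalIntegral.integral_const_mul, intervalIntegral.integral_add
        (continuousOn_heatDissipation.mono hsub).intervalIntegrable
        ((continuousOn_V.mono hsub).intervalIntegrable.const_mul _),
        intervalIntegral.integral_const_mul]
      have h1 := hJ t ht
      have h2 := hI t ht
      gcongr)
    (fun t ht => ?_) (T := T) hT
  · refine ⟨(1 + N 0) * exp (2 * (J + (K₁ + K₂) * I)), ?_, fun t ht => ?_⟩
    · have := hN0 0
      positivity
    · simpa using hgron t ht
  · have hV := V_nonneg_s8 (S := S) ht
    have hD := heatDissipation_nonneg (S := S) ht
    have hNt := hN0 t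
    have hθu : ∀ x ∈ Icc (0:ℝ) 1, S.θ x t / S.u x t ≤ C₀ / m * (1 + S.V t) := fun x hx => by
      have h1 := hθ x hx t ht
      have h2 := hu x hx t ht
      have h3 := S.hθ_pos x hx t ht
      calc _ ≤ C₀ * (1 + S.V t) / m := by gcongr
        _ = _ := by ring
    have hQt : C₀ / m * (1 + S.V t) * (∫ x in (0:ℝ)..1, S.velocityDefect x t ^ 2)
        ≤ K₁ * S.V t := by
      rw [hK₁, mul_assoc, mul_assoc]
      refine mul_le_mul_of_nonneg_left ?_ (by positivity)
      have h0 : 0 ≤ ∫ x in (0:ℝ)..1, S.velocityDefect x t ^ 2 :=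
        integral_nonneg_Icc fun x _ => sq_nonneg _
      have h1 := hQ' t ht
      rcases le_total (S.V t) δ with h | h
      · have h2 := hQ t ht h
        calc _ ≤ (1 + δ) * (B * S.V t) := by gcongr
          _ ≤ (1 + δ) * (B * S.V t) + (1 / δ + 1) * Q * S.V t :=
            le_add_of_nonneg_right (by positivity)
          _ = _ := by ring
      · have hδV : 1 ≤ S.V t / δ := (one_le_div hδ).2 h
        calc _ ≤ (S.V t / δ + S.V t) * Q := by gcongr
          _ ≤ (1 + δ) * (B * S.V t) + (S.V t / δ + S.V t) * Q :=
            le_add_of_nonneg_left (by positivity)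
          _ = _ := by ring
    have hκ : ∀ x ∈ Icc (0:ℝ) 1, S.geomMeanRate t * (x - 1 / 2) * S.effectiveGradient x t
        - S.θ x t / S.u x t * S.effectiveGradient x t ^ 2 / 2
        ≤ K₂ * S.V t * (1 + S.effectiveGradient x t ^ 2) := by
      intro x hx
      have hut := hu x hx t ht
      have hu0 := S.hu_pos x hx t ht
      have hθ0 := S.hθ_pos x hx t ht
      have hx2 : (x - 1 / 2) ^ 2 ≤ 1 := by nlinarith [hx.1, hx.2]
      set p := S.effectiveGradient x t
      set r := S.geomMeanRate t
      rcases le_total (S.V t) δ with h | h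
      · have h1 : r ^ 2 ≤ _ := sq_geomMeanRate_le hm ht (fun x hx => hu x hx t ht) (hg t ht).2
        have h2 : c / M ≤ S.θ x t / S.u x t :=
          div_le_div₀ hθ0.le (hδθ t ht h x hx).1 hu0 (hu' x hx t ht)
        have h3 : r * (x - 1 / 2) * p ≤ r ^ 2 * (M / c) + c / M * p ^ 2 / 2 := by
          have h4 : r ^ 2 * (x - 1 / 2) ^ 2 * (M / c) ≤ r ^ 2 * (M / c) :=
            mul_le_mul_of_nonneg_right (mul_le_of_le_one_right (sq_nonneg r) hx2) (by positivity)
          have h5 : r ^ 2 * (x - 1 / 2) ^ 2 * (M / c) + c / M * p ^ 2 / 2 - r * (x - 1 / 2) * p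
              = c / (2 * M) * ((p - r * (x - 1 / 2) * (M / c)) ^ 2
                + (r * (x - 1 / 2) * (M / c)) ^ 2) := by
            field_simp
            ring
          have h6 : 0 ≤ c / (2 * M) * ((p - r * (x - 1 / 2) * (M / c)) ^ 2
                + (r * (x - 1 / 2) * (M / c)) ^ 2) := by positivity
          linarith
        have h7 : r ^ 2 * (M / c) ≤ 2 * G ^ 2 * (δ + S.E₀ / m) * (M / c) * S.V t := by
          calc _ ≤ 2 * G ^ 2 * (S.V t + S.E₀ / m) * S.V t * (M / c) := by gcongr
            _ ≤ 2 * G ^ 2 * (δ + S.E₀ / m) * S.V t * (M / c) := by gcongr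
            _ = _ := by ring
        have h8 := mul_le_mul_of_nonneg_right h2 (sq_nonneg p)
        have h9 : 0 ≤ G * (2 + S.E₀ / m / δ) * S.V t := by positivity
        have h10 : K₂ * S.V t ≤ K₂ * S.V t * (1 + p ^ 2) :=
          le_mul_of_one_le_right (by positivity) (by linarith [sq_nonneg p])
        have h11 : K₂ * S.V t = 2 * G ^ 2 * (δ + S.E₀ / m) * (M / c) * S.V t
          + G * (2 + S.E₀ / m / δ) * S.V t := by rw [hK₂]; ring
        linarith
      · have hδV : 1 ≤ S.V t / δ := (one_le_div hδ).2 h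
        have h1 : |r| ≤ _ := abs_geomMeanRate_le hm ht (fun x hx => hu x hx t ht) (hg t ht).2
        have h2 : |r| ≤ K₂ * S.V t := by
          calc _ ≤ _ := h1
            _ ≤ G * (2 * S.V t + S.E₀ / m * (S.V t / δ)) := by
              gcongr
              exact le_mul_of_one_le_right (by positivity) hδV
            _ ≤ 2 * G ^ 2 * (δ + S.E₀ / m) * (M / c) * S.V t
                + G * (2 * S.V t + S.E₀ / m * (S.V t / δ)) :=
              le_add_of_nonneg_left (by positivity)
            _ = _ := by rw [hK₂]; ring
        have h3 : |(x - 1 / 2) * p| ≤ 1 + p ^ 2 := by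
          refine abs_le_of_sq_le_sq ?_ (by positivity)
          rw [mul_pow]
          nlinarith [mul_le_mul_of_nonneg_right hx2 (sq_nonneg p), sq_nonneg p,
            sq_nonneg (p ^ 2)]
        have h4 : r * (x - 1 / 2) * p ≤ K₂ * S.V t * (1 + p ^ 2) := by
          rw [mul_assoc]
          refine (le_abs_self _).trans ?_
          rw [abs_mul]
          exact mul_le_mul h2 h3 (abs_nonneg _) ((abs_nonneg _).trans h2)
        have h5 : 0 ≤ S.θ x t / S.u x t * p ^ 2 / 2 := by positivity
        linarith
    refine (integral_effectiveGradient_mul_le ht hθu hκ).trans ?_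
    have h1 : 0 ≤ (S.heatDissipation t + K₁ * S.V t) * N t := by positivity
    change 2 * (S.heatDissipation t + _ + K₂ * S.V t * (1 + N t)) ≤
      -0 + 2 * (S.heatDissipation t + (K₁ + K₂) * S.V t) * (1 + N t)
    linarith

variable (S) in
lemma exists_integral_sq_ux_le : ∃ C, 0 ≤ C ∧ ∀ t ∈ Ici (0:ℝ),
    ∫ x in (0:ℝ)..1, S.ux x t ^ 2 ≤ C := by
  obtain ⟨N, hN0, hN⟩ := S.exists_integral_sq_effectiveGradient_le
  obtain ⟨Q, hQ0, hQ⟩ := S.exists_integral_sq_velocityDefect_le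
  obtain ⟨M, hM, hu⟩ := S.exists_u_le
  refine ⟨M ^ 2 * (2 * (N + Q)), by positivity, fun t ht => ?_⟩
  have c1 : ContinuousOn (fun x => S.effectiveGradient x t ^ 2) (Icc 0 1) :=
    (continuousOn_slice_fst S.continuousOn_effectiveGradient ht).pow 2
  have c2 : ContinuousOn (fun x => S.velocityDefect x t ^ 2) (Icc 0 1) :=
    (continuousOn_slice_fst S.continuousOn_velocityDefect ht).pow 2
  have c3 : ContinuousOn (fun x => S.ux x t ^ 2) (Icc 0 1) :=
    (continuousOn_slice_fst S.continuousOn_ux ht).pow 2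
  calc _ ≤ ∫ x in (0:ℝ)..1,
        M ^ 2 * (2 * (S.effectiveGradient x t ^ 2 + S.velocityDefect x t ^ 2)) := by
        refine integral_mono_Icc c3
          (continuousOn_const.mul (continuousOn_const.mul (c1.add c2))) fun x hx => ?_
        have h1 := S.hu_pos x hx t ht
        have h2 : S.ux x t = S.u x t * (S.effectiveGradient x t + S.velocityDefect x t) := by
          rw [effectiveGradient]; field_simp; ring
        rw [h2, mul_pow]
        refine mul_le_mul (pow_le_pow_left₀ h1.le (hu x hx t ht) 2) ?_ (sq_nonneg _) (sq_nonneg _)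
        nlinarith [sq_nonneg (S.effectiveGradient x t - S.velocityDefect x t)]
    _ = M ^ 2 * (2 * ((∫ x in (0:ℝ)..1, S.effectiveGradient x t ^ 2)
        + ∫ x in (0:ℝ)..1, S.velocityDefect x t ^ 2)) := by
        rw [intervalIntegral.integral_const_mul, intervalIntegral.integral_const_mul,
          intervalIntegral.integral_add (intervalIntegrable_of_Icc c1)
          (intervalIntegrable_of_Icc c2)]
    _ ≤ _ := by
        have := hN t ht
        have := hQ t ht
        gcongr

variable (S) in
lemma exists_integral_sq_θx_div_le : ∃ C, 0 ≤ C ∧ ∀ T ∈ Ici (0:ℝ),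
    ∫ t in (0:ℝ)..T, ∫ x in (0:ℝ)..1, S.θx x t ^ 2 / S.θ x t ≤ C := by
  obtain ⟨J, hJ0, hJ⟩ := S.exists_integral_heatDissipation_le
  obtain ⟨M, hM, hu⟩ := S.exists_u_le
  refine ⟨M * J, by positivity, fun T hT => ?_⟩
  have c1 : ContinuousOn (fun p : ℝ × ℝ => S.θx p.1 p.2 ^ 2 / S.θ p.1 p.2) strip :=
    (continuousOn_θx.pow 2).div continuousOn_θ θ_ne_zero
  have c2 : ContinuousOn (fun p : ℝ × ℝ => S.θx p.1 p.2 ^ 2 / (S.u p.1 p.2 * S.θ p.1 p.2)) strip :=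
    (continuousOn_θx.pow 2).div (continuousOn_u.mul continuousOn_θ) fun p hp =>
      mul_ne_zero (u_ne_zero p hp) (θ_ne_zero p hp)
  have hsub : uIcc 0 T ⊆ Ici (0:ℝ) := by
    rw [uIcc_of_le (mem_Ici.1 hT)]; exact Icc_subset_Ici_self
  calc _ ≤ ∫ t in (0:ℝ)..T, M * S.heatDissipation t := by
        refine intervalIntegral.integral_mono_on hT
          ((continuousOn_integral (F := fun x t => S.θx x t ^ 2 / S.θ x t)
            c1).mono hsub).intervalIntegrable
          ((continuousOn_heatDissipation.mono hsub).intervalIntegrable.const_mul M)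
          fun t ht => ?_
        rw [heatDissipation, ← intervalIntegral.integral_const_mul]
        refine integral_mono_Icc
          (continuousOn_slice_fst (F := fun x t => S.θx x t ^ 2 / S.θ x t) c1 ht.1)
          (continuousOn_const.mul (continuousOn_slice_fst
            (F := fun x t => S.θx x t ^ 2 / (S.u x t * S.θ x t)) c2 ht.1)) fun x hx => ?_
        have h1 := S.hu_pos x hx t ht.1
        have h2 := S.hθ_pos x hx t ht.1
        have h3 := hu x hx t ht.1
        rw [show S.θx x t ^ 2 / S.θ x t
          = S.u x t * (S.θx x t ^ 2 / (S.u x t * S.θ x t)) by field_simp]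
        gcongr
    _ = M * ∫ t in (0:ℝ)..T, S.heatDissipation t := intervalIntegral.integral_const_mul _ _
    _ ≤ _ := mul_le_mul_of_nonneg_left (hJ T hT) hM.le

end Gradient

end NSSol

/-- Uniform bound: `sup_{0≤t≤T} ∫₀¹ u_x² dx + ∫₀ᵀ∫₀¹ θ_x²/θ dx dt ≤ C`, with `C`
independent of `T`. -/
theorem ux_and_entropy_dissipation_bound (S : NSSol) :
    ∃ C > (0:ℝ), ∀ T > (0:ℝ),
      sSup ((fun t => ∫ x in (0:ℝ)..1, (S.ux x t) ^ 2) '' Icc (0:ℝ) T)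
        + (∫ t in (0:ℝ)..T, ∫ x in (0:ℝ)..1, (S.θx x t) ^ 2 / S.θ x t) ≤ C := by
  obtain ⟨C₁, h₁, hC₁⟩ := S.exists_integral_sq_ux_le
  obtain ⟨C₂, h₂, hC₂⟩ := S.exists_integral_sq_θx_div_le
  refine ⟨C₁ + C₂ + 1, by positivity, fun T hT => ?_⟩
  have h := csSup_le ((nonempty_Icc.2 hT.le).image fun t => ∫ x in (0:ℝ)..1, (S.ux x t) ^ 2)
    (a := C₁) (by rintro _ ⟨t, ht, rfl⟩; exact hC₁ t ht.1)
  linarith [hC₂ T hT.le]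
end
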